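/- arXiv:0904.0428 — 2 statements merged into one kernel-verified Lean document; each statement's English description precedes it below -/
import Mathlib

section
/- Technical testing lemma for supersolutions: let Ω be an open set containing 0, let u be a viscosity supersolution of u_t − F(x, ∇u, D²u) − h(x,t)·∇u|∇u|^α ≥ f(x,t) in Q_T = Ω × (0,T) with f lower semicontinuous, let C₁ be a constant, φ a C² function on (0,T), k > max(2, (α+2)/(α+1)), and (0, t̄) ∈ Ω × (0,T) such that for some δ₁ > 0 one has inf_{x ∈ B(0,δ₁), |t−t̄| < δ₁} ( u(x,t) − φ(t) + C₁|x|^k ) = u(0, t̄) (with φ(t̄) = 0). Then φ′(t̄) ≥ f(0, t̄). -/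
open Set Filter Metric
open scoped RealInnerProductSpace

noncomputable section

/-- Euclidean space `ℝ^N`. -/
abbrev EucSp (N : ℕ) := EuclideanSpace ℝ (Fin N)

/-- `N × N` real matrices. -/
abbrev MatN (N : ℕ) := Matrix (Fin N) (Fin N) ℝ

variable {N : ℕ}

/-- Spatial Hessian matrix of a function `φ : ℝ^N → ℝ`. -/
noncomputable def hessMat (φ : EucSp N → ℝ) (x : EucSp N) : MatN N := fun i j =>
  iteratedFDeriv ℝ 2 φ x ![EuclideanSpace.single i (1 : ℝ), EuclideanSpace.single j (1 : ℝ)]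

/-- Upper semicontinuous envelope `u*`. -/
noncomputable def uscEnv (u : EucSp N → ℝ → ℝ) (x : EucSp N) (t : ℝ) : ℝ :=
  Filter.limsup (fun p : EucSp N × ℝ => u p.1 p.2) (nhds (x, t))

/-- Lower semicontinuous envelope `u_*`. -/
noncomputable def lscEnv (u : EucSp N → ℝ → ℝ) (x : EucSp N) (t : ℝ) : ℝ :=
  Filter.liminf (fun p : EucSp N × ℝ => u p.1 p.2) (nhds (x, t))

/-- The first order term `h(x,t)·p |p|^α`. -/
noncomputable def gradTerm (h : EucSp N → ℝ → EucSp N) (α : ℝ) (x : EucSp N) (t : ℝ)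
    (p : EucSp N) : ℝ :=
  ⟪h x t, p⟫ * ‖p‖ ^ α

/-- Viscosity subsolution of `u_t - F(x,∇u,D²u) - h(x,t)·∇u|∇u|^α ≤ f` in `Ω × (0,T)`,
in the sense of Definition 1 of the paper. -/
def IsSubSol (Ω : Set (EucSp N)) (T : ℝ) (F : EucSp N → EucSp N → MatN N → ℝ)
    (h : EucSp N → ℝ → EucSp N) (α : ℝ) (f : EucSp N → ℝ → ℝ)
    (u : EucSp N → ℝ → ℝ) : Prop :=
  ∀ x₀ ∈ Ω, ∀ t₀ ∈ Set.Ioo (0 : ℝ) T,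
    (∀ φ : EucSp N → ℝ → ℝ,
      ContDiff ℝ 2 (fun p : EucSp N × ℝ => φ p.1 p.2) →
      (∀ᶠ p : EucSp N × ℝ in nhds (x₀, t₀), uscEnv u p.1 p.2 ≤ φ p.1 p.2) →
      uscEnv u x₀ t₀ = φ x₀ t₀ →
      gradient (fun x => φ x t₀) x₀ ≠ 0 →
      deriv (fun s => φ x₀ s) t₀
          - F x₀ (gradient (fun x => φ x t₀) x₀) (hessMat (fun x => φ x t₀) x₀)
          - gradTerm h α x₀ t₀ (gradient (fun x => φ x t₀) x₀)
        ≤ f x₀ t₀) ∧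
    (∀ δ₁ > (0 : ℝ), ∀ φ : ℝ → ℝ, ContDiff ℝ 2 φ → φ t₀ = 0 →
      (∀ t ∈ Set.Ioo (t₀ - δ₁) (t₀ + δ₁), uscEnv u x₀ t - φ t ≤ uscEnv u x₀ t₀) →
      (∀ᶠ x in nhds x₀,
        sSup ((fun t => uscEnv u x t - φ t) '' Set.Ioo (t₀ - δ₁) (t₀ + δ₁)) =
          sSup ((fun t => uscEnv u x₀ t - φ t) '' Set.Ioo (t₀ - δ₁) (t₀ + δ₁))) →
      deriv φ t₀ ≤ f x₀ t₀)

/-- Viscosity supersolution of `u_t - F(x,∇u,D²u) - h(x,t)·∇u|∇u|^α ≥ f` in `Ω × (0,T)`,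
in the sense of Definition 1 of the paper. -/
def IsSuperSol (Ω : Set (EucSp N)) (T : ℝ) (F : EucSp N → EucSp N → MatN N → ℝ)
    (h : EucSp N → ℝ → EucSp N) (α : ℝ) (f : EucSp N → ℝ → ℝ)
    (u : EucSp N → ℝ → ℝ) : Prop :=
  ∀ x₀ ∈ Ω, ∀ t₀ ∈ Set.Ioo (0 : ℝ) T,
    (∀ φ : EucSp N → ℝ → ℝ,
      ContDiff ℝ 2 (fun p : EucSp N × ℝ => φ p.1 p.2) →
      (∀ᶠ p : EucSp N × ℝ in nhds (x₀, t₀), φ p.1 p.2 ≤ lscEnv u p.1 p.2) →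
      lscEnv u x₀ t₀ = φ x₀ t₀ →
      gradient (fun x => φ x t₀) x₀ ≠ 0 →
      f x₀ t₀ ≤
        deriv (fun s => φ x₀ s) t₀
          - F x₀ (gradient (fun x => φ x t₀) x₀) (hessMat (fun x => φ x t₀) x₀)
          - gradTerm h α x₀ t₀ (gradient (fun x => φ x t₀) x₀)) ∧
    (∀ δ₁ > (0 : ℝ), ∀ φ : ℝ → ℝ, ContDiff ℝ 2 φ → φ t₀ = 0 →
      (∀ t ∈ Set.Ioo (t₀ - δ₁) (t₀ + δ₁), lscEnv u x₀ t₀ ≤ lscEnv u x₀ t - φ t) →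
      (∀ᶠ x in nhds x₀,
        sInf ((fun t => lscEnv u x t - φ t) '' Set.Ioo (t₀ - δ₁) (t₀ + δ₁)) =
          sInf ((fun t => lscEnv u x₀ t - φ t) '' Set.Ioo (t₀ - δ₁) (t₀ + δ₁))) →
      f x₀ t₀ ≤ deriv φ t₀)

/-- Continuity of `F` on `Ω × (ℝ^N∖{0}) × S`. -/
def Fcont (Ω : Set (EucSp N)) (F : EucSp N → EucSp N → MatN N → ℝ) : Prop :=
  ContinuousOn (fun z : EucSp N × EucSp N × MatN N => F z.1 z.2.1 z.2.2)
    (Ω ×ˢ ({p : EucSp N | p ≠ 0} ×ˢ (Set.univ : Set (MatN N))))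

/-- Hypothesis (H1): homogeneity. -/
def H1 (Ω : Set (EucSp N)) (F : EucSp N → EucSp N → MatN N → ℝ) (α : ℝ) : Prop :=
  ∀ x ∈ Ω, ∀ p : EucSp N, p ≠ 0 → ∀ X : MatN N, X.IsSymm →
    ∀ t : ℝ, t ≠ 0 → ∀ μ : ℝ, 0 ≤ μ →
      F x (t • p) (μ • X) = |t| ^ α * μ * F x p X

/-- Hypothesis (H2): uniform ellipticity. -/
def H2 (Ω : Set (EucSp N)) (F : EucSp N → EucSp N → MatN N → ℝ) (α a A : ℝ) : Prop :=
  0 < a ∧ a ≤ A ∧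
    ∀ x ∈ Ω, ∀ p : EucSp N, p ≠ 0 → ∀ M P : MatN N, M.IsSymm → P.IsSymm → P.PosSemidef →
      a * ‖p‖ ^ α * P.trace ≤ F x p (M + P) - F x p M ∧
        F x p (M + P) - F x p M ≤ A * ‖p‖ ^ α * P.trace

/-- Hypothesis (H3): continuity estimate for doubled variables. -/
def H3 (Ω : Set (EucSp N)) (F : EucSp N → EucSp N → MatN N → ℝ) : Prop :=
  ∃ ω : ℝ → ℝ, Continuous ω ∧ ω 0 = 0 ∧
    ∀ X Y : MatN N, X.IsSymm → Y.IsSymm → ∀ ζ : ℝ, 0 < ζ →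
      (Matrix.fromBlocks X 0 0 Y +
        ζ • (1 : Matrix (Fin N ⊕ Fin N) (Fin N ⊕ Fin N) ℝ)).PosSemidef →
      ((4 * ζ) • Matrix.fromBlocks (1 : MatN N) (-1) (-1) (1 : MatN N) -
        Matrix.fromBlocks X 0 0 Y).PosSemidef →
      ∀ x ∈ Ω, ∀ y ∈ Ω, x ≠ y →
        F x (ζ • (x - y)) X - F y (ζ • (x - y)) (-Y) ≤ ω (ζ * ‖x - y‖ ^ 2)

/-- Frobenius norm of a matrix. -/
noncomputable def frobNorm (X : MatN N) : ℝ := Real.sqrt (∑ i, ∑ j, (X i j) ^ 2)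

/-- Hypothesis (H4): Hölder-type continuity of `F` in `x`. -/
def H4 (Ω : Set (EucSp N)) (F : EucSp N → EucSp N → MatN N → ℝ) (α : ℝ) : Prop :=
  ∃ ω' : ℝ → ℝ, Continuous ω' ∧ ω' 0 = 0 ∧
    ∀ x ∈ Ω, ∀ y ∈ Ω, ∀ p : EucSp N, p ≠ 0 → ∀ X : MatN N, X.IsSymm →
      |F x p X - F y p X| ≤ ω' ‖x - y‖ * ‖p‖ ^ α * frobNorm X

/-- Hypothesis (H5): regularity of `h`. -/
def H5 (Ω : Set (EucSp N)) (T : ℝ) (h : EucSp N → ℝ → EucSp N) (α : ℝ) : Prop :=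
  ∃ ωh : ℝ, 0 < ωh ∧ ωh ≤ 1 ∧ ∃ ch : ℝ, 0 < ch ∧
    (∀ x ∈ Ω, ∀ t ∈ Set.Ioo (0 : ℝ) T, ∀ s ∈ Set.Ioo (0 : ℝ) T,
      ‖h x t - h x s‖ ≤ ch * |t - s| ^ ωh) ∧
    (α ≤ 0 → ∀ x ∈ Ω, ∀ y ∈ Ω, ∀ t ∈ Set.Ioo (0 : ℝ) T,
      ‖h x t - h y t‖ ≤ ch * ‖x - y‖ ^ (1 + α)) ∧
    (0 < α → ∀ x ∈ Ω, ∀ y ∈ Ω, ∀ t ∈ Set.Ioo (0 : ℝ) T,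
      ⟪h x t - h y t, x - y⟫ ≤ 0)

/-- Hypothesis (H6): uniform Lipschitz-type condition on `F` in the gradient variable. -/
def H6 (F : EucSp N → EucSp N → MatN N → ℝ) (α : ℝ) : Prop :=
  ∃ C : ℝ, 0 < C ∧ ∀ x : EucSp N, ∀ p : EucSp N, p ≠ 0 → ∀ q : EucSp N, ‖q‖ < ‖p‖ / 2 →
    ∀ X : MatN N, X.IsSymm →
      |F x (p + q) X - F x p X| ≤ C * ‖p‖ ^ (α - 1) * ‖q‖ * frobNorm X

/-- `h` is continuous and bounded on `Ω × (0,T)`. -/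
def HContBdd (Ω : Set (EucSp N)) (T : ℝ) (h : EucSp N → ℝ → EucSp N) : Prop :=
  ContinuousOn (fun p : EucSp N × ℝ => h p.1 p.2) (Ω ×ˢ Set.Ioo 0 T) ∧
    ∃ C : ℝ, ∀ x ∈ Ω, ∀ t ∈ Set.Ioo (0 : ℝ) T, ‖h x t‖ ≤ C

/-- Uniform exterior cone condition. -/
def UnifExtCone (Ω : Set (EucSp N)) : Prop :=
  ∃ φ₀ ∈ Set.Ioo (0 : ℝ) Real.pi, ∃ r : ℝ, 0 < r ∧
    ∀ z ∈ frontier Ω, ∃ n : EucSp N, ‖n‖ = 1 ∧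
      {x : EucSp N | ⟪x - z, n⟫ ≤ Real.cos φ₀ * ‖x - z‖} ∩ closure Ω ∩
        Metric.ball z r = {z}

/-- `u = ψ` on the parabolic boundary `(∂Ω × (0,T)) ∪ (Ω × {0})`. -/
def BoundaryEq (Ω : Set (EucSp N)) (T : ℝ) (u ψ : EucSp N → ℝ → ℝ) : Prop :=
  (∀ x ∈ frontier Ω, ∀ t ∈ Set.Ioo (0 : ℝ) T, u x t = ψ x t) ∧
    (∀ x ∈ Ω, u x 0 = ψ x 0)

/-- The global barrier family of Proposition 1 of the paper, with Hölder
exponent `γ` and constants `c₁ ≤ W_z(x)/|x-z|^γ ≤ c₂`. -/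
def IsBarrierFamily (Ω : Set (EucSp N)) (T : ℝ) (F : EucSp N → EucSp N → MatN N → ℝ)
    (h : EucSp N → ℝ → EucSp N) (α γ c₁ c₂ : ℝ) : Prop :=
  γ ∈ Set.Ioo (0 : ℝ) 1 ∧ 0 < c₁ ∧ 0 < c₂ ∧
    ∀ z ∈ frontier Ω, ∃ W : EucSp N → ℝ,
      ContinuousOn W (closure Ω) ∧ W z = 0 ∧
      (∀ x ∈ Ω, x ≠ z → 0 < W x) ∧
      (∀ x ∈ Ω, gradient W x ≠ 0) ∧
      (∀ x ∈ Ω, c₁ * ‖x - z‖ ^ γ ≤ W x ∧ W x ≤ c₂ * ‖x - z‖ ^ γ) ∧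
      (∀ x₀ ∈ Ω, ∀ φ : EucSp N → ℝ, ContDiff ℝ 2 φ →
        (∀ᶠ x in nhds x₀, φ x ≤ W x) → φ x₀ = W x₀ → gradient φ x₀ ≠ 0 →
        ∀ t ∈ Set.Ioo (0 : ℝ) T,
          F x₀ (gradient φ x₀) (hessMat φ x₀) + gradTerm h α x₀ t (gradient φ x₀) ≤ -1)

/-- `ψ` is `γ`-Hölder in `x` (with constant `cψ`) and Lipschitz in `t`
(with constant `Lψ`). -/
def PsiHolderLip (Ω : Set (EucSp N)) (T γ cψ Lψ : ℝ) (ψ : EucSp N → ℝ → ℝ) : Prop :=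
  (∀ x ∈ closure Ω, ∀ y ∈ closure Ω, ∀ t ∈ Set.Icc (0 : ℝ) T,
      |ψ x t - ψ y t| ≤ cψ * ‖x - y‖ ^ γ) ∧
    (∀ x ∈ closure Ω, ∀ t ∈ Set.Icc (0 : ℝ) T, ∀ s ∈ Set.Icc (0 : ℝ) T,
      |ψ x t - ψ x s| ≤ Lψ * |t - s|)

/-- A continuous viscosity solution of the problem `1_{f,ψ}` on a bounded domain. -/
def IsSolution (Ω : Set (EucSp N)) (T : ℝ) (F : EucSp N → EucSp N → MatN N → ℝ)
    (h : EucSp N → ℝ → EucSp N) (α : ℝ) (f : EucSp N → ℝ → ℝ)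
    (ψ : EucSp N → ℝ → ℝ) (u : EucSp N → ℝ → ℝ) : Prop :=
  ContinuousOn (fun p : EucSp N × ℝ => u p.1 p.2) (closure Ω ×ˢ Set.Icc 0 T) ∧
    IsSubSol Ω T F h α f u ∧ IsSuperSol Ω T F h α f u ∧ BoundaryEq Ω T u ψ

lemma exists_contDiff_eventuallyEq {E : Type*} [NormedAddCommGroup E] [InnerProductSpace ℝ E]
    [FiniteDimensional ℝ E] {f : E → ℝ} {x : E} (hf : ContDiffAt ℝ 2 f x) :
    ∃ g : E → ℝ, ContDiff ℝ 2 g ∧ g =ᶠ[nhds x] f := by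
  obtain ⟨ε, hε, hball⟩ := Metric.eventually_nhds_iff_ball.1
    (hf.eventually (by simp))
  let b : ContDiffBump x := ⟨ε / 3, ε / 2, by positivity, by linarith⟩
  refine ⟨fun y => b y * f y, ?_, ?_⟩
  · rw [contDiff_iff_contDiffAt]
    intro y
    by_cases hy : y ∈ Metric.ball x ε
    · exact b.contDiff.contDiffAt.mul (hball y hy)
    · have hyt : y ∉ tsupport b := by
        rw [b.tsupport_eq]
        intro hy'
        exact hy (Metric.closedBall_subset_ball (by change ε / 2 < ε; linarith) hy')
      have h0 : (fun y => b y * f y) =ᶠ[nhds y] fun _ => 0 := by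
        filter_upwards [notMem_tsupport_iff_eventuallyEq.1 hyt] with z hz
        simp [hz]
      exact contDiffAt_const.congr_of_eventuallyEq h0
  · filter_upwards [b.eventuallyEq_one] with y hy
    simp [hy]

lemma eq_of_le_add_mul_norm_rpow {E : Type*} [NormedAddCommGroup E] [InnerProductSpace ℝ E]
    {w : E → ℝ} {s : Set E} (hs : IsOpen s) (hconv : Convex ℝ s) {C k : ℝ} (hk : 1 < k)
    (hw : ∀ x ∈ s, ∀ z ∈ s, w x ≤ w z + C * ‖x - z‖ ^ k) {x z : E} (hx : x ∈ s) (hz : z ∈ s) :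
    w x = w z := by
  have hder : ∀ y ∈ s, HasFDerivAt w (0 : E →L[ℝ] ℝ) y := by
    intro y hy
    refine .of_isLittleO ?_
    have h1 : (fun y' => w y' - w y - (0 : E →L[ℝ] ℝ) (y' - y)) =O[nhds y]
        fun y' => ‖y' - y‖ ^ k := by
      refine Asymptotics.IsBigO.of_bound |C| ?_
      filter_upwards [hs.mem_nhds hy] with y' hy'
      have e1 := hw y' hy' y hy
      have e2 := hw y hy y' hy'
      rw [norm_sub_rev] at e2
      have h0 : 0 ≤ ‖y' - y‖ ^ k := by positivity
      have h3 : C * ‖y' - y‖ ^ k ≤ |C| * ‖y' - y‖ ^ k :=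
        mul_le_mul_of_nonneg_right (le_abs_self C) h0
      rw [Real.norm_of_nonneg h0, Real.norm_eq_abs, abs_le]
      simp only [_root_.zero_apply, sub_zero]
      constructor <;> linarith
    refine h1.trans_isLittleO ?_
    have h3 : HasFDerivAt (fun z => z - y) (ContinuousLinearMap.id ℝ E) y :=
      (hasFDerivAt_id y).sub_const y
    have h2 := ((hasFDerivAt_norm_rpow (y - y) hk).comp (f := fun z => z - y) y h3).isLittleO
    refine h2.congr_left fun y' => ?_
    simp [(by linarith : k ≠ 0)]
  have hd : DifferentiableOn ℝ w s := fun y hy => (hder y hy).differentiableAt.differentiableWithinAt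
  exact hconv.is_const_of_fderivWithin_eq_zero hd
    (fun y hy => by rw [fderivWithin_of_isOpen hs hy, (hder y hy).fderiv]) hx hz

lemma lscEnv_le {u : EucSp N → ℝ → ℝ} {x : EucSp N} {t c : ℝ}
    (hc : ∀ᶠ p : EucSp N × ℝ in nhds (x, t), c ≤ u p.1 p.2) : lscEnv u x t ≤ u x t :=
  csSup_le ⟨c, by simpa using hc⟩ fun _ hb => by
    have := Filter.Eventually.self_of_nhds (Filter.eventually_map.1 hb)
    simpa using this

lemma le_lscEnv_of_eventually {u : EucSp N → ℝ → ℝ} {x : EucSp N} {t c : ℝ}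
    (hc : ∀ᶠ p : EucSp N × ℝ in nhds (x, t), c ≤ u p.1 p.2) : c ≤ lscEnv u x t := by
  refine le_csSup ⟨u x t, fun b hb => ?_⟩ (by simpa using hc)
  simpa using Filter.Eventually.self_of_nhds (Filter.eventually_map.1 hb)

lemma le_lscEnv_of_continuousAt {u : EucSp N → ℝ → ℝ} {g : EucSp N × ℝ → ℝ} {x : EucSp N} {t : ℝ}
    (hg : ContinuousAt g (x, t)) (hc : ∀ᶠ p : EucSp N × ℝ in nhds (x, t), g p ≤ u p.1 p.2) :
    g (x, t) ≤ lscEnv u x t := by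
  refine le_of_forall_lt fun c hcg => ?_
  obtain ⟨d, hcd, hd⟩ := exists_between hcg
  refine hcd.trans_le (le_lscEnv_of_eventually ?_)
  filter_upwards [hg.eventually (lt_mem_nhds hd), hc] with p h1 h2
  exact h1.le.trans h2

lemma lowerSemicontinuousAt_lscEnv {u : EucSp N → ℝ → ℝ} {x : EucSp N} {t b : ℝ}
    (hb : ∀ᶠ p : EucSp N × ℝ in nhds (x, t), b ≤ u p.1 p.2) :
    LowerSemicontinuousAt (fun p : EucSp N × ℝ => lscEnv u p.1 p.2) (x, t) := by
  intro c hc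
  obtain ⟨a, ha, hca⟩ := exists_lt_of_lt_csSup (⟨b, by simpa using hb⟩) hc
  have ha' : ∀ᶠ p : EucSp N × ℝ in nhds (x, t), a ≤ u p.1 p.2 := by simpa using ha
  filter_upwards [ha'.eventually_nhds] with q hq
  exact hca.trans_le (le_lscEnv_of_eventually hq)

lemma hasFDerivAt_norm_rpow_of_ne_zero {E : Type*} [NormedAddCommGroup E] [InnerProductSpace ℝ E]
    (x : E) {q : ℝ} (hx : x ≠ 0) :
    HasFDerivAt (fun z : E => ‖z‖ ^ q) ((q * ‖x‖ ^ (q - 2)) • innerSL ℝ x) x := by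
  apply HasStrictFDerivAt.hasFDerivAt
  convert! (hasStrictFDerivAt_norm_sq x).rpow_const (p := q / 2) (by simp [hx]) using 0
  simp_rw [← Real.rpow_natCast_mul (norm_nonneg _), ← Nat.cast_smul_eq_nsmul ℝ, smul_smul]
  ring_nf

/-- The profile `x ↦ -C ‖x - a‖ ^ k` used as a spatial test function. -/
def powTest (C k : ℝ) (a x : EucSp N) : ℝ := -(C * ‖x - a‖ ^ k)

lemma hasFDerivAt_powTest {C k : ℝ} {a x : EucSp N} (hx : x ≠ a) :
    HasFDerivAt (powTest C k a) ((-(C * k * ‖x - a‖ ^ (k - 2))) • innerSL ℝ (x - a)) x := by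
  have h1 : HasFDerivAt (fun z : EucSp N => z - a) (ContinuousLinearMap.id ℝ (EucSp N)) x :=
    (hasFDerivAt_id x).sub_const a
  have h := (((hasFDerivAt_norm_rpow_of_ne_zero (x - a) (q := k) (sub_ne_zero.2 hx)).comp x h1).const_mul
    C).neg
  refine h.congr_fderiv ?_
  ext v
  simp
  ring

lemma gradient_powTest {C k : ℝ} {a x : EucSp N} (hx : x ≠ a) :
    gradient (powTest C k a) x = (-(C * k * ‖x - a‖ ^ (k - 2))) • (x - a) := by
  apply HasGradientAt.gradient
  rw [hasGradientAt_iff_hasFDerivAt]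
  refine (hasFDerivAt_powTest hx).congr_fderiv ?_
  ext v
  simp

lemma contDiffAt_powTest {C k : ℝ} {a x : EucSp N} (hx : x ≠ a) :
    ContDiffAt ℝ 2 (powTest C k a) x := by
  unfold powTest
  have h1 : ContDiffAt ℝ 2 (fun z : EucSp N => ‖z - a‖) x :=
    (contDiffAt_id.sub contDiffAt_const).norm ℝ (sub_ne_zero.2 hx)
  exact (contDiffAt_const.mul (h1.rpow_const_of_ne (norm_ne_zero_iff.2 (sub_ne_zero.2 hx)))).neg

lemma hessMat_powTest {C k : ℝ} {a x : EucSp N} (hx : x ≠ a) :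
    hessMat (powTest C k a) x = -((C * k) • (‖x - a‖ ^ (k - 2) • (1 : MatN N) +
      ((k - 2) * ‖x - a‖ ^ (k - 4)) • Matrix.vecMulVec (x - a).ofLp (x - a).ofLp)) := by
  have hev : fderiv ℝ (powTest C k a) =ᶠ[nhds x]
      fun z => (-(C * k)) • (‖z - a‖ ^ (k - 2) • innerSL ℝ (z - a)) := by
    filter_upwards [isOpen_ne.mem_nhds hx] with z hz
    rw [(hasFDerivAt_powTest hz).fderiv, smul_smul]
    congr 1
    ring
  have h1 : HasFDerivAt (fun z : EucSp N => z - a) (ContinuousLinearMap.id ℝ (EucSp N)) x :=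
    (hasFDerivAt_id x).sub_const a
  have hp := (hasFDerivAt_norm_rpow_of_ne_zero (x - a) (q := k - 2) (sub_ne_zero.2 hx)).comp x h1
  have hi := (innerSL ℝ (E := EucSp N)).hasFDerivAt.comp x h1
  have h2 := (hp.smul hi).const_smul (-(C * k))
  ext i j
  have h3 : hessMat (powTest C k a) x i j = fderiv ℝ (fderiv ℝ (powTest C k a)) x
      (EuclideanSpace.single i 1) (EuclideanSpace.single j 1) := by
    simp [hessMat, iteratedFDeriv_two_apply]
  have h4 : fderiv ℝ (fderiv ℝ (powTest C k a)) x = _ := hev.fderiv_eq.trans h2.fderiv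
  have h5 : ∀ (w : EucSp N) (l : Fin N), innerSL ℝ w (EuclideanSpace.single l 1) = w.ofLp l :=
    fun w l => by
      rw [innerSL_apply_apply, EuclideanSpace.inner_single_right]
      simp
  have h6 : k - 2 - 2 = k - 4 := by ring
  rw [h3, h4]
  simp only [Function.comp_apply, ContinuousLinearMap.comp_id, _root_.smul_apply, _root_.add_apply,
    ContinuousLinearMap.smulRight_apply, h5, h6, Matrix.neg_apply, Matrix.smul_apply,
    Matrix.add_apply, Matrix.vecMulVec_apply, Matrix.one_apply, smul_eq_mul, PiLp.single_apply,
    eq_comm (a := j)]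
  ring

lemma neg_F_neg_le {Ω : Set (EucSp N)} {F : EucSp N → EucSp N → MatN N → ℝ} {α a A : ℝ}
    (hF1 : H1 Ω F α) (hF2 : H2 Ω F α a A) {x p : EucSp N} (hx : x ∈ Ω) (hp : p ≠ 0) {P : MatN N}
    (hP : P.PosSemidef) : -F x p (-P) ≤ A * ‖p‖ ^ α * P.trace := by
  have hsymm : P.IsSymm := by
    have := hP.isHermitian
    rwa [Matrix.IsHermitian, Matrix.conjTranspose_eq_transpose_of_trivial] at this
  have h0 : F x p 0 = 0 := by
    simpa using hF1 x hx p hp 0 Matrix.isSymm_zero 1 one_ne_zero 0 le_rfl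
  have h := (hF2.2.2 x hx p hp (-P) P hsymm.neg hsymm hP).2
  rw [neg_add_cancel, h0] at h
  linarith

lemma powTest_operator_le {Ω : Set (EucSp N)} {F : EucSp N → EucSp N → MatN N → ℝ}
    {h : EucSp N → ℝ → EucSp N} {α a A B C k t : ℝ} {x y : EucSp N}
    (hF1 : H1 Ω F α) (hF2 : H2 Ω F α a A) (hk : 2 < k) (hC : 0 < C)
    (hy : y ∈ Ω) (hyx : y ≠ x) (hB : ‖h y t‖ ≤ B) :
    -F y (gradient (powTest C k x) y) (hessMat (powTest C k x) y)
        - gradTerm h α y t (gradient (powTest C k x) y) ≤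
      A * (C * k) ^ α * (C * k * (N + (k - 2))) * ‖y - x‖ ^ ((k - 1) * α + (k - 2)) +
        B * (C * k) ^ (1 + α) * ‖y - x‖ ^ ((k - 1) * (1 + α)) := by
  have hd : 0 < ‖y - x‖ := norm_pos_iff.2 (sub_ne_zero.2 hyx)
  have hCk : 0 < C * k := by positivity
  have hp : gradient (powTest C k x) y ≠ 0 := by
    rw [gradient_powTest hyx]
    exact smul_ne_zero (neg_ne_zero.2 (by positivity)) (sub_ne_zero.2 hyx)
  have hpn : ‖gradient (powTest C k x) y‖ = C * k * ‖y - x‖ ^ (k - 1) := by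
    rw [gradient_powTest hyx, norm_smul, Real.norm_eq_abs, abs_neg, abs_of_pos (by positivity),
      mul_assoc, ← Real.rpow_add_one hd.ne']
    ring_nf
  have hP : ((C * k) • (‖y - x‖ ^ (k - 2) • (1 : MatN N) +
      ((k - 2) * ‖y - x‖ ^ (k - 4)) • Matrix.vecMulVec (y - x).ofLp (y - x).ofLp)).PosSemidef := by
    refine Matrix.PosSemidef.smul (Matrix.PosSemidef.add ?_ ?_) hCk.le
    · exact Matrix.PosSemidef.one.smul (by positivity)
    · refine Matrix.PosSemidef.smul ?_ (mul_nonneg (by linarith) (by positivity))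
      simpa using Matrix.posSemidef_vecMulVec_self_star (y - x).ofLp
  have htr : ((C * k) • (‖y - x‖ ^ (k - 2) • (1 : MatN N) +
      ((k - 2) * ‖y - x‖ ^ (k - 4)) • Matrix.vecMulVec (y - x).ofLp (y - x).ofLp)).trace =
      C * k * (N + (k - 2)) * ‖y - x‖ ^ (k - 2) := by
    have h1 : (Matrix.vecMulVec (y - x).ofLp (y - x).ofLp).trace = ‖y - x‖ ^ (2 : ℝ) := by
      rw [Real.rpow_two, EuclideanSpace.real_norm_sq_eq]
      simp [Matrix.trace, Matrix.vecMulVec_apply, sq]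
    have h2 : ‖y - x‖ ^ (k - 2) = ‖y - x‖ ^ (k - 4) * ‖y - x‖ ^ (2 : ℝ) := by
      rw [← Real.rpow_add hd]
      ring_nf
    rw [Matrix.trace_smul, Matrix.trace_add, Matrix.trace_smul, Matrix.trace_smul, h1]
    simp only [Matrix.trace_one, Fintype.card_fin, smul_eq_mul]
    rw [mul_assoc (k - 2), ← h2]
    ring
  have hFle := neg_F_neg_le hF1 hF2 hy hp hP
  rw [← hessMat_powTest hyx, htr] at hFle
  have hg : -gradTerm h α y t (gradient (powTest C k x) y) ≤
      B * ‖gradient (powTest C k x) y‖ ^ (1 + α) := by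
    unfold gradTerm
    rw [Real.rpow_add (norm_pos_iff.2 hp), Real.rpow_one, ← neg_mul, ← mul_assoc]
    refine mul_le_mul_of_nonneg_right ?_ (by positivity)
    refine (neg_le_abs _).trans ((abs_real_inner_le_norm _ _).trans ?_)
    exact mul_le_mul_of_nonneg_right hB (norm_nonneg _)
  rw [hpn, Real.mul_rpow hCk.le (by positivity), ← Real.rpow_mul hd.le] at hFle hg
  have e : ‖y - x‖ ^ ((k - 1) * α + (k - 2)) =
      ‖y - x‖ ^ ((k - 1) * α) * ‖y - x‖ ^ (k - 2) := Real.rpow_add hd _ _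
  rw [e]
  calc _ ≤ _ := add_le_add hFle hg
    _ = _ := by ring

/-- If the partial infimum `x ↦ inf_t (v x t - ψ t)` is not locally constant at `0`, then `v - ψ`
is touched from below, arbitrarily close to `(0, t₀)`, by translates of `-C ‖x‖ ^ k` at points
different from the vertex. -/
lemma exists_touching_of_not_eventually_const {E : Type*} [NormedAddCommGroup E]
    [InnerProductSpace ℝ E] [FiniteDimensional ℝ E] {v : E → ℝ → ℝ} {ψ : ℝ → ℝ}
    {t₀ δ C₁ k : ℝ} (hδ : 0 < δ) (hC₁ : 0 < C₁) (hk : 1 < k) (hψ : Continuous ψ)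
    (hψ0 : ψ t₀ = 0)
    (hlsc : LowerSemicontinuousOn (fun p : E × ℝ => v p.1 p.2)
      (closedBall 0 δ ×ˢ Icc (t₀ - δ) (t₀ + δ)))
    (hmin : ∀ x ∈ closedBall (0 : E) δ, ∀ t ∈ Icc (t₀ - δ) (t₀ + δ),
      v 0 t₀ + (t - t₀) ^ 2 ≤ v x t - ψ t + C₁ * ‖x‖ ^ k)
    (hnc : ¬ ∀ᶠ x in nhds (0 : E), sInf ((fun t => v x t - ψ t) '' Ioo (t₀ - δ) (t₀ + δ)) =
      sInf ((fun t => v 0 t - ψ t) '' Ioo (t₀ - δ) (t₀ + δ))) :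
    ∃ C > 0, ∀ ρ > 0, ∃ (a y : E) (s : ℝ), ‖y‖ < ρ ∧ |s - t₀| < ρ ∧ ‖y - a‖ < ρ ∧ y ≠ a ∧
      ∀ᶠ p : E × ℝ in nhds (y, s),
        v y s - ψ s + C * ‖y - a‖ ^ k ≤ v p.1 p.2 - ψ p.2 + C * ‖p.1 - a‖ ^ k := by
  set w : E → ℝ := fun x => sInf ((fun t => v x t - ψ t) '' Ioo (t₀ - δ) (t₀ + δ)) with hw
  have hne : (Ioo (t₀ - δ) (t₀ + δ)).Nonempty := ⟨t₀, by constructor <;> linarith⟩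
  have hbdd : ∀ x ∈ closedBall (0 : E) δ,
      BddBelow ((fun t => v x t - ψ t) '' Ioo (t₀ - δ) (t₀ + δ)) := by
    rintro x hx
    refine ⟨v 0 t₀ - C₁ * ‖x‖ ^ k, ?_⟩
    rintro _ ⟨t, ht, rfl⟩
    have := hmin x hx t (Ioo_subset_Icc_self ht)
    dsimp only
    nlinarith [sq_nonneg (t - t₀)]
  -- the constant of the comparison profile
  set C : ℝ := 2 * 2 ^ k * C₁ with hCdef
  have hC : 0 < C := by positivity
  refine ⟨C, hC, fun ρ hρ => ?_⟩
  -- how close the vertex must be to the origin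
  obtain ⟨r, hr, hrδ, hrρ⟩ : ∃ r > 0, r ≤ δ ∧ ∀ a y : E, ∀ τ : ℝ, ‖a‖ < r →
      C / 2 * ‖y - a‖ ^ k + τ ^ 2 ≤ 3 * C / 2 * ‖a‖ ^ k →
      ‖y‖ < min ρ δ ∧ |τ| < min ρ δ ∧ ‖y - a‖ < ρ := by
    have hm : 0 < min ρ δ := lt_min hρ hδ
    have hmρ : min ρ δ ≤ ρ := min_le_left _ _
    set m := min ρ δ
    refine ⟨min (min δ 1) (min (m / 4) (m ^ 2 / (2 * C))), by positivity,
      (min_le_left _ _).trans (min_le_left _ _), fun a y τ ha hle => ?_⟩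
    obtain ⟨⟨-, ha1⟩, ham, haC⟩ : (‖a‖ < δ ∧ ‖a‖ < 1) ∧ ‖a‖ < m / 4 ∧ ‖a‖ < m ^ 2 / (2 * C) := by
      simpa [lt_min_iff] using ha
    have hpow : 0 ≤ ‖y - a‖ ^ k := by positivity
    have hya : ‖y - a‖ ≤ 3 * ‖a‖ := by
      rw [← Real.rpow_le_rpow_iff (norm_nonneg _) (by positivity) (zero_lt_one.trans hk),
        Real.mul_rpow (by norm_num) (norm_nonneg _)]
      have h3 : (3 : ℝ) ≤ 3 ^ k := Real.self_le_rpow_of_one_le (by norm_num) hk.le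
      have h4 : ‖y - a‖ ^ k ≤ 3 * ‖a‖ ^ k := by
        have : C / 2 * ‖y - a‖ ^ k ≤ C / 2 * (3 * ‖a‖ ^ k) := by nlinarith [sq_nonneg τ]
        exact le_of_mul_le_mul_left this (by positivity)
      exact h4.trans (mul_le_mul_of_nonneg_right h3 (by positivity))
    have hy : ‖y‖ ≤ ‖y - a‖ + ‖a‖ := by simpa using norm_add_le (y - a) a
    refine ⟨by linarith, ?_, by linarith⟩
    have hak : ‖a‖ ^ k ≤ ‖a‖ := Real.rpow_le_self_of_le_one (norm_nonneg _) ha1.le hk.le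
    rw [lt_div_iff₀ (by positivity)] at haC
    refine abs_lt_of_sq_lt_sq ?_ hm.le
    have h5 : 0 ≤ C / 2 * ‖y - a‖ ^ k := by positivity
    have h6 : C * ‖a‖ ^ k ≤ C * ‖a‖ := mul_le_mul_of_nonneg_left hak hC.le
    nlinarith [norm_nonneg a, sq_nonneg m]
  have hex : ∃ x ∈ ball (0 : E) r, ∃ z ∈ ball (0 : E) r, w z + C * ‖x - z‖ ^ k < w x := by
    by_contra! hcon
    refine hnc ?_
    filter_upwards [ball_mem_nhds (0 : E) hr] with x hx
    exact eq_of_le_add_mul_norm_rpow isOpen_ball (convex_ball 0 r) hk hcon hx (mem_ball_self hr)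
  obtain ⟨a, ha, z, hz, haz⟩ := hex
  have hbc : ball (0 : E) r ⊆ closedBall 0 δ :=
    ball_subset_closedBall.trans (closedBall_subset_closedBall hrδ)
  obtain ⟨_, ⟨τ, hτ, rfl⟩, hτlt⟩ := exists_lt_of_csInf_lt (hne.image _) (lt_sub_iff_add_lt.2 haz)
  dsimp only at hτlt
  have hcont : Continuous fun p : E × ℝ => -ψ p.2 + C * ‖p.1 - a‖ ^ k := by
    have : Continuous fun p : E × ℝ => ‖p.1 - a‖ ^ k :=
      (by fun_prop : Continuous fun p : E × ℝ => ‖p.1 - a‖).rpow_const fun _ => .inr (by linarith)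
    fun_prop
  have hK : IsCompact (closedBall (0 : E) δ ×ˢ Icc (t₀ - δ) (t₀ + δ)) :=
    (isCompact_closedBall _ _).prod isCompact_Icc
  have h0K : ((0 : E), t₀) ∈ closedBall (0 : E) δ ×ˢ Icc (t₀ - δ) (t₀ + δ) :=
    ⟨mem_closedBall_self hδ.le, by constructor <;> linarith⟩
  obtain ⟨⟨y, s⟩, hys, hysmin⟩ := LowerSemicontinuousOn.exists_isMinOn ⟨_, h0K⟩ hK
    (hlsc.add hcont.continuousOn.lowerSemicontinuousOn)
  have hm : ∀ x ∈ closedBall (0 : E) δ, ∀ t ∈ Icc (t₀ - δ) (t₀ + δ),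
      v y s - ψ s + C * ‖y - a‖ ^ k ≤ v x t - ψ t + C * ‖x - a‖ ^ k := by
    intro x hx t ht
    have := isMinOn_iff.1 hysmin (x, t) ⟨hx, ht⟩
    dsimp only at this
    linarith
  have hloc : C / 2 * ‖y - a‖ ^ k + (s - t₀) ^ 2 ≤ 3 * C / 2 * ‖a‖ ^ k := by
    have h1 := hm 0 h0K.1 t₀ h0K.2
    have h2 := hmin y hys.1 s hys.2
    have h3 : ‖y‖ ^ k ≤ 2 ^ k * (‖y - a‖ ^ k + ‖a‖ ^ k) := by
      have hy : ‖y‖ ≤ ‖y - a‖ + ‖a‖ := by simpa using norm_add_le (y - a) a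
      have hy2 : ‖y‖ ≤ 2 * max ‖y - a‖ ‖a‖ := by
        linarith [le_max_left ‖y - a‖ ‖a‖, le_max_right ‖y - a‖ ‖a‖]
      refine (Real.rpow_le_rpow (norm_nonneg _) hy2 (by linarith)).trans ?_
      rw [Real.mul_rpow (by norm_num) (by positivity)]
      refine mul_le_mul_of_nonneg_left ?_ (by positivity)
      have e1 : 0 ≤ ‖y - a‖ ^ k := by positivity
      have e2 : 0 ≤ ‖a‖ ^ k := by positivity
      rcases max_choice ‖y - a‖ ‖a‖ with e | e <;> rw [e] <;> linarith
    have h4 : C₁ * ‖y‖ ^ k ≤ C / 2 * (‖y - a‖ ^ k + ‖a‖ ^ k) := by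
      rw [hCdef]
      nlinarith
    rw [hψ0, zero_sub, norm_neg] at h1
    nlinarith
  obtain ⟨hy, hs, hya⟩ := hrρ a y (s - t₀) (by simpa using ha) hloc
  have hsI : s ∈ Ioo (t₀ - δ) (t₀ + δ) := by
    have := abs_lt.1 (hs.trans_le (min_le_right _ _))
    constructor <;> linarith
  refine ⟨a, y, s, hy.trans_le (min_le_left _ _), hs.trans_le (min_le_left _ _), hya, ?_, ?_⟩
  · rintro rfl
    have h1 := hm z (hbc hz) τ (Ioo_subset_Icc_self hτ)
    have h2 : w y ≤ v y s - ψ s := csInf_le (hbdd y hys.1) ⟨s, hsI, rfl⟩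
    have h3 : ‖y - y‖ ^ k = 0 := by
      simp [(by linarith : k ≠ 0)]
    rw [h3, norm_sub_rev] at h1
    linarith
  · have hyB : y ∈ ball (0 : E) δ := by simpa using hy.trans_le (min_le_right _ _)
    filter_upwards [prod_mem_nhds (isOpen_ball.mem_nhds hyB) (isOpen_Ioo.mem_nhds hsI)] with p hp
    exact hm p.1 (ball_subset_closedBall hp.1) p.2 (Ioo_subset_Icc_self hp.2)

/-- Technical testing lemma for supersolutions (Lemma 1 of the paper). -/
theorem testing_lemma_supersolution
    (N : ℕ) (hN : 1 ≤ N) (α : ℝ) (hα : -1 < α)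
    (Ω : Set (EucSp N)) (hΩo : IsOpen Ω) (h0Ω : (0 : EucSp N) ∈ Ω)
    (T : ℝ) (hT : 0 < T)
    (F : EucSp N → EucSp N → MatN N → ℝ) (a A : ℝ)
    (hFc : Fcont Ω F) (hF1 : H1 Ω F α) (hF2 : H2 Ω F α a A)
    (h : EucSp N → ℝ → EucSp N) (hh : HContBdd Ω T h)
    (f : EucSp N → ℝ → ℝ)
    (hflsc : LowerSemicontinuousOn (fun p : EucSp N × ℝ => f p.1 p.2) (Ω ×ˢ Set.Ioo 0 T))
    (u : EucSp N → ℝ → ℝ) (hu : IsSuperSol Ω T F h α f u)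
    (C₁ : ℝ) (φ : ℝ → ℝ) (hφ : ContDiffOn ℝ 2 φ (Set.Ioo 0 T))
    (k : ℝ) (hk : max 2 ((α + 2) / (α + 1)) < k)
    (t₀ : ℝ) (ht₀ : t₀ ∈ Set.Ioo (0 : ℝ) T)
    (δ₁ : ℝ) (hδ₁ : 0 < δ₁)
    (hball : Metric.ball (0 : EucSp N) δ₁ ⊆ Ω)
    (hint : Set.Ioo (t₀ - δ₁) (t₀ + δ₁) ⊆ Set.Ioo 0 T)
    (hφt₀ : φ t₀ = 0)
    (hinf : ∀ x ∈ Metric.ball (0 : EucSp N) δ₁, ∀ t ∈ Set.Ioo (t₀ - δ₁) (t₀ + δ₁),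
      u 0 t₀ ≤ u x t - φ t + C₁ * ‖x‖ ^ k) :
    f 0 t₀ ≤ deriv φ t₀ := by
  obtain ⟨-, B, hB⟩ := hh
  have hk2 : 2 < k := (le_max_left _ _).trans_lt hk
  have hk1 : 1 < k := by linarith
  have hkα : α + 2 < k * (α + 1) := by
    rw [← div_lt_iff₀ (by linarith)]
    exact (le_max_right _ _).trans_lt hk
  set D : ℝ := max C₁ 1 with hD
  have hD0 : 0 < D := lt_max_of_lt_right one_pos
  have hφt : ContDiffAt ℝ 2 φ t₀ := hφ.contDiffAt (isOpen_Ioo.mem_nhds ht₀)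
  have hcyl : ∀ x ∈ ball (0 : EucSp N) δ₁, ∀ t ∈ Ioo (t₀ - δ₁) (t₀ + δ₁),
      ∀ᶠ p : EucSp N × ℝ in nhds (x, t), u 0 t₀ + φ p.2 - D * ‖p.1‖ ^ k ≤ u p.1 p.2 := by
    intro x hx t ht
    filter_upwards [prod_mem_nhds (isOpen_ball.mem_nhds hx) (isOpen_Ioo.mem_nhds ht)] with p hp
    have h1 := hinf p.1 hp.1 p.2 hp.2
    have h2 : C₁ * ‖p.1‖ ^ k ≤ D * ‖p.1‖ ^ k :=
      mul_le_mul_of_nonneg_right (le_max_left _ _) (by positivity)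
    linarith
  have hgcont : ∀ x : EucSp N, ∀ t ∈ Ioo (t₀ - δ₁) (t₀ + δ₁),
      ContinuousAt (fun p : EucSp N × ℝ => u 0 t₀ + φ p.2 - D * ‖p.1‖ ^ k) (x, t) := by
    intro x t ht
    have h1 : ContinuousAt (fun p : EucSp N × ℝ => φ p.2) (x, t) :=
      ContinuousAt.comp (f := Prod.snd)
        (hφ.continuousOn.continuousAt (isOpen_Ioo.mem_nhds (hint ht))) continuousAt_snd
    have h2 : Continuous fun p : EucSp N × ℝ => ‖p.1‖ ^ k :=
      continuous_fst.norm.rpow_const fun _ => .inr (by linarith)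
    exact (continuousAt_const.add h1).sub (continuousAt_const.mul h2.continuousAt)
  have hlb : ∀ x ∈ ball (0 : EucSp N) δ₁, ∀ t ∈ Ioo (t₀ - δ₁) (t₀ + δ₁),
      u 0 t₀ + φ t - D * ‖x‖ ^ k ≤ lscEnv u x t := fun x hx t ht =>
    le_lscEnv_of_continuousAt (hgcont x t ht) (hcyl x hx t ht)
  have hbd : ∀ x ∈ ball (0 : EucSp N) δ₁, ∀ t ∈ Ioo (t₀ - δ₁) (t₀ + δ₁),
      ∃ b, ∀ᶠ p : EucSp N × ℝ in nhds (x, t), b ≤ u p.1 p.2 := by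
    intro x hx t ht
    refine ⟨u 0 t₀ + φ t - D * ‖x‖ ^ k - 1, ?_⟩
    filter_upwards [hcyl x hx t ht,
      (hgcont x t ht).eventually (lt_mem_nhds (sub_one_lt _))] with p h1 h2
    exact h2.le.trans h1
  have h0I : t₀ ∈ Ioo (t₀ - δ₁) (t₀ + δ₁) := by constructor <;> linarith
  have hu0 : lscEnv u 0 t₀ = u 0 t₀ := by
    refine le_antisymm ?_ ?_
    · obtain ⟨b, hb⟩ := hbd 0 (mem_ball_self hδ₁) t₀ h0I
      exact lscEnv_le hb
    · simpa [hφt₀, (by linarith : k ≠ 0)] using hlb 0 (mem_ball_self hδ₁) t₀ h0I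
  -- a global time profile that makes the minimum strict in time
  obtain ⟨ψ, hψ, hψe⟩ := exists_contDiff_eventuallyEq
    (f := fun t => φ t - (t - t₀) ^ 2) (x := t₀) (hφt.sub (by fun_prop))
  have hψ0 : ψ t₀ = 0 := by simp [hψe.self_of_nhds, hφt₀]
  have hψd : deriv ψ t₀ = deriv φ t₀ := by
    have h1 : HasDerivAt (fun t : ℝ => (t - t₀) ^ 2) 0 t₀ := by
      simpa using ((hasDerivAt_id t₀).sub_const t₀).fun_pow 2
    have h2 := (hφt.differentiableAt (by norm_num)).hasDerivAt.sub h1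
    rw [hψe.deriv_eq, ← sub_zero (deriv φ t₀)]
    exact h2.deriv
  obtain ⟨ε, hε, hψε⟩ := Metric.eventually_nhds_iff_ball.1 hψe
  obtain ⟨δ, hδ, hδm⟩ := exists_between (lt_min hδ₁ hε)
  have hδδ₁ : δ < δ₁ := hδm.trans_le (min_le_left _ _)
  have hδε : δ < ε := hδm.trans_le (min_le_right _ _)
  have hballsub : closedBall (0 : EucSp N) δ ⊆ ball 0 δ₁ := closedBall_subset_ball hδδ₁
  have hIsub : Icc (t₀ - δ) (t₀ + δ) ⊆ Ioo (t₀ - δ₁) (t₀ + δ₁) := fun t ht =>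
    ⟨by linarith [ht.1], by linarith [ht.2]⟩
  have hmin : ∀ x ∈ closedBall (0 : EucSp N) δ, ∀ t ∈ Icc (t₀ - δ) (t₀ + δ),
      lscEnv u 0 t₀ + (t - t₀) ^ 2 ≤ lscEnv u x t - ψ t + D * ‖x‖ ^ k := by
    intro x hx t ht
    have h1 := hlb x (hballsub hx) t (hIsub ht)
    have h2 := hψε t (by
      rw [mem_ball, Real.dist_eq, abs_lt]
      exact ⟨by linarith [ht.1], by linarith [ht.2]⟩)
    rw [h2, hu0]
    linarith
  have hlsc : LowerSemicontinuousOn (fun p : EucSp N × ℝ => lscEnv u p.1 p.2)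
      (closedBall 0 δ ×ˢ Icc (t₀ - δ) (t₀ + δ)) := by
    rintro ⟨x, t⟩ ⟨hx, ht⟩
    obtain ⟨b, hb⟩ := hbd x (hballsub hx) t (hIsub ht)
    exact (lowerSemicontinuousAt_lscEnv hb).lowerSemicontinuousWithinAt _
  rw [← hψd]
  by_cases hconst : ∀ᶠ x in nhds (0 : EucSp N),
      sInf ((fun t => lscEnv u x t - ψ t) '' Ioo (t₀ - δ) (t₀ + δ)) =
        sInf ((fun t => lscEnv u 0 t - ψ t) '' Ioo (t₀ - δ) (t₀ + δ))
  · refine (hu 0 h0Ω t₀ ht₀).2 δ hδ ψ hψ hψ0 (fun t ht => ?_) hconst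
    have h1 := hmin 0 (mem_closedBall_self hδ.le) t (Ioo_subset_Icc_self ht)
    rw [norm_zero, Real.zero_rpow (by linarith), mul_zero] at h1
    nlinarith [sq_nonneg (t - t₀)]
  obtain ⟨C, hC, htouch⟩ := exists_touching_of_not_eventually_const hδ hD0 hk1 hψ.continuous hψ0
    hlsc hmin hconst
  set K₁ : ℝ := A * (C * k) ^ α * (C * k * (N + (k - 2)))
  set K₂ : ℝ := B * (C * k) ^ (1 + α)
  set e₁ : ℝ := (k - 1) * α + (k - 2) with he₁
  set e₂ : ℝ := (k - 1) * (1 + α) with he₂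
  have he₁0 : 0 < e₁ := by rw [he₁]; linarith
  have he₂0 : 0 < e₂ := mul_pos (by linarith) (by linarith)
  have hkey : ∀ ρ > 0, ∃ (y : EucSp N) (s d : ℝ), ‖y‖ < ρ ∧ |s - t₀| < ρ ∧ |d| < ρ ∧
      f y s ≤ deriv ψ s + (K₁ * |d| ^ e₁ + K₂ * |d| ^ e₂) := by
    intro ρ hρ
    obtain ⟨a', y, s, hy, hs, hya, hne, htc⟩ := htouch (min ρ δ) (lt_min hρ hδ)
    have hyΩ : y ∈ Ω := hball (hballsub (by simpa using (hy.trans_le (min_le_right _ _)).le))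
    have hsT : s ∈ Ioo 0 T := by
      have := abs_lt.1 (hs.trans_le (min_le_right _ _))
      exact hint (hIsub ⟨by linarith, by linarith⟩)
    refine ⟨y, s, ‖y - a'‖, hy.trans_le (min_le_left _ _), hs.trans_le (min_le_left _ _),
      by simpa using hya.trans_le (min_le_left _ _), ?_⟩
    obtain ⟨q, hq, hqe⟩ := exists_contDiff_eventuallyEq (contDiffAt_powTest (C := C) (k := k) hne)
    set c : ℝ := lscEnv u y s - ψ s + C * ‖y - a'‖ ^ k with hc
    have hgrad : gradient (fun x => ψ s + q x + c) y = gradient (powTest C k a') y := by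
      have h1 : HasGradientAt (powTest C k a') (gradient (powTest C k a') y) y :=
        ((contDiffAt_powTest hne).differentiableAt (by norm_num)).hasGradientAt
      have h2 : HasFDerivAt (fun x => ψ s + q x + c) _ y :=
        ((h1.hasFDerivAt.congr_of_eventuallyEq hqe).const_add (ψ s)).add_const c
      exact HasGradientAt.gradient (hasGradientAt_iff_hasFDerivAt.2 h2)
    have hhess : hessMat (fun x => ψ s + q x + c) y = hessMat (powTest C k a') y := by
      have h1 : fderiv ℝ (fun x => ψ s + q x + c) =ᶠ[nhds y] fderiv ℝ (powTest C k a') := by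
        filter_upwards [hqe.fderiv (𝕜 := ℝ)] with x hx
        rw [fderiv_add_const c, fderiv_const_add (ψ s), hx]
      ext i j
      simp only [hessMat, iteratedFDeriv_two_apply, h1.fderiv_eq]
    have hder : deriv (fun r => ψ r + q y + c) s = deriv ψ s := by
      simp
    have htest := (hu y hyΩ s hsT).1 (fun x r => ψ r + q x + c)
      (by
        have h1 : ContDiff ℝ 2 fun p : EucSp N × ℝ => ψ p.2 := hψ.comp contDiff_snd
        have h2 : ContDiff ℝ 2 fun p : EucSp N × ℝ => q p.1 := hq.comp contDiff_fst
        exact (h1.add h2).add contDiff_const)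
      (by
        filter_upwards [htc, continuous_fst.continuousAt.eventually hqe] with p hp hp2
        rw [hp2, powTest]
        linarith)
      (by
        rw [hqe.self_of_nhds, powTest, hc]
        ring)
      (by
        rw [hgrad, gradient_powTest hne]
        have : 0 < ‖y - a'‖ := norm_pos_iff.2 (sub_ne_zero.2 hne)
        exact smul_ne_zero (neg_ne_zero.2 (by positivity)) (sub_ne_zero.2 hne))
    rw [hgrad, hhess, hder] at htest
    have hop := powTest_operator_le (h := h) (t := s) hF1 hF2 hk2 hC hyΩ hne (hB y hyΩ s hsT)
    rw [abs_of_nonneg (norm_nonneg _)]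
    linarith
  refine le_of_forall_pos_le_add fun η hη => ?_
  have hf : ∀ᶠ p : EucSp N × ℝ in nhds ((0 : EucSp N), t₀), f 0 t₀ - η / 2 < f p.1 p.2 := by
    have h1 := hflsc ((0 : EucSp N), t₀) ⟨h0Ω, ht₀⟩ (f 0 t₀ - η / 2) (by dsimp only; linarith)
    rwa [IsOpen.nhdsWithin_eq (hΩo.prod isOpen_Ioo) ⟨h0Ω, ht₀⟩] at h1
  have hR : ∀ᶠ p : ℝ × ℝ in nhds (t₀, (0 : ℝ)),
      deriv ψ p.1 + (K₁ * |p.2| ^ e₁ + K₂ * |p.2| ^ e₂) < deriv ψ t₀ + η / 2 := by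
    have h1 : Continuous (deriv ψ) := hψ.continuous_deriv (by norm_num)
    have h2 : Continuous fun p : ℝ × ℝ => |p.2| ^ e₁ :=
      continuous_snd.abs.rpow_const fun _ => .inr he₁0.le
    have h3 : Continuous fun p : ℝ × ℝ => |p.2| ^ e₂ :=
      continuous_snd.abs.rpow_const fun _ => .inr he₂0.le
    have h4 : Continuous fun p : ℝ × ℝ =>
      deriv ψ p.1 + (K₁ * |p.2| ^ e₁ + K₂ * |p.2| ^ e₂) := by fun_prop
    refine h4.continuousAt.eventually (gt_mem_nhds ?_)
    simp [he₁0.ne', he₂0.ne', hη]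
  obtain ⟨ρ₁, hρ₁, hfρ⟩ := Metric.eventually_nhds_iff.1 hf
  obtain ⟨ρ₂, hρ₂, hRρ⟩ := Metric.eventually_nhds_iff.1 hR
  obtain ⟨y, s, d, hy, hs, hd, hle⟩ := hkey (min ρ₁ ρ₂) (lt_min hρ₁ hρ₂)
  have h1 := @hfρ (y, s) (by
    rw [Prod.dist_eq, max_lt_iff, dist_zero_right, Real.dist_eq]
    exact ⟨hy.trans_le (min_le_left _ _), hs.trans_le (min_le_left _ _)⟩)
  have h2 := @hRρ (s, d) (by
    rw [Prod.dist_eq, max_lt_iff, Real.dist_eq, Real.dist_eq, sub_zero]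
    exact ⟨hs.trans_le (min_le_right _ _), hd.trans_le (min_le_right _ _)⟩)
  dsimp only at h1 h2
  linarith
end
end

section
/- Existence of parabolic barriers: suppose ψ, defined on the parabolic boundary ∂Q_T, is Lipschitz continuous in t and Hölder continuous with exponent γ in x (γ from the global barrier), and f is uniformly bounded. Then there exists a continuous viscosity supersolution W of 1_{|f|_∞, ψ}, i.e. W is a viscosity supersolution of u_t = F(x,∇u,D²u) + h(x,t)·∇u|∇u|^α + |f|_∞ in Q_T with W = ψ on ∂Q_T; similarly there exists a continuous viscosity subsolution V of 1_{−|f|_∞, ψ}, and V ≤ W. -/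
open Set Filter Metric
open scoped RealInnerProductSpace

noncomputable section

variable {N : ℕ}

/-! ### Second order touching -/

theorem IsLocalMin.second_deriv_nonneg {f f₁ : ℝ → ℝ} {x f₂ : ℝ} (hf : IsLocalMin f x)
    (h₁ : ∀ᶠ s in nhds x, HasDerivAt f (f₁ s) s) (h₂ : HasDerivAt f₁ f₂ x) : 0 ≤ f₂ := by
  by_contra! hneg
  have hd : deriv f =ᶠ[nhds x] f₁ := h₁.mono fun s hs => hs.deriv
  have hdd : deriv (deriv f) x = f₂ := by rw [hd.deriv_eq, h₂.deriv]
  have hmax : IsLocalMax f x := isLocalMax_of_deriv_deriv_neg (by rw [hdd]; exact hneg)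
    hf.deriv_eq_zero h₁.self_of_nhds.continuousAt
  have hconst : f =ᶠ[nhds x] fun _ => f x := by
    filter_upwards [hf, hmax] with s h1 h2 using le_antisymm h2 h1
  have hz : deriv f =ᶠ[nhds x] fun _ => 0 := by
    filter_upwards [hconst.eventuallyEq_nhds] with s hs
    rw [hs.deriv_eq, deriv_const]
  rw [hz.deriv_eq, deriv_const] at hdd
  exact hneg.ne hdd.symm

theorem hessMat_apply (φ : EucSp N → ℝ) (x : EucSp N) (i j : Fin N) :
    hessMat φ x i j = fderiv ℝ (fderiv ℝ φ) x (EuclideanSpace.single i (1 : ℝ))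
      (EuclideanSpace.single j (1 : ℝ)) := by
  simp [hessMat, iteratedFDeriv_two_apply]

theorem hessMat_isSymm {φ : EucSp N → ℝ} (hφ : ContDiff ℝ 2 φ) (x : EucSp N) :
    (hessMat φ x).IsSymm := by
  ext i j
  rw [Matrix.transpose_apply, hessMat_apply, hessMat_apply]
  exact (hφ.contDiffAt.isSymmSndFDerivAt (by simp)).eq _ _

theorem hessMat_quadForm (φ : EucSp N → ℝ) (x v : EucSp N) :
    (v : Fin N → ℝ) ⬝ᵥ (hessMat φ x).mulVec v = fderiv ℝ (fderiv ℝ φ) x v v := by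
  have hv : v = ∑ i, v i • EuclideanSpace.single i (1 : ℝ) := by
    ext j
    simp [Finset.sum_apply, Pi.single_apply]
  conv_rhs => rw [hv]
  simp only [map_sum, map_smul, _root_.sum_apply, _root_.smul_apply,
    dotProduct, Matrix.mulVec, hessMat_apply, smul_eq_mul, Finset.mul_sum]
  rw [Finset.sum_comm]
  refine Finset.sum_congr rfl fun i _ => Finset.sum_congr rfl fun j _ => ?_
  ring

theorem hasDerivAt_line {φ : EucSp N → ℝ} (hφ : ContDiff ℝ 2 φ) (x v : EucSp N) (s : ℝ) :
    HasDerivAt (fun s : ℝ => φ (x + s • v)) (fderiv ℝ φ (x + s • v) v) s := by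
  have hl : HasDerivAt (fun s : ℝ => x + s • v) v s := by
    simpa using ((hasDerivAt_id s).smul_const v).const_add x
  exact ((hφ.differentiable (by norm_num)) _).hasFDerivAt.comp_hasDerivAt s hl

theorem hasDerivAt_fderiv_line {φ : EucSp N → ℝ} (hφ : ContDiff ℝ 2 φ) (x v : EucSp N) :
    HasDerivAt (fun s : ℝ => fderiv ℝ φ (x + s • v) v) (fderiv ℝ (fderiv ℝ φ) x v v) 0 := by
  have hl : HasDerivAt (fun s : ℝ => x + s • v) v 0 := by
    simpa using ((hasDerivAt_id (0 : ℝ)).smul_const v).const_add x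
  have hd : Differentiable ℝ (fderiv ℝ φ) :=
    (hφ.fderiv_right (m := 1) (by norm_num)).differentiable (by norm_num)
  have h2 : HasFDerivAt (fderiv ℝ φ) (fderiv ℝ (fderiv ℝ φ) x) (x + (0 : ℝ) • v) := by
    rw [zero_smul, add_zero]
    exact (hd x).hasFDerivAt
  have h3 : HasDerivAt (fun s : ℝ => fderiv ℝ φ (x + s • v)) (fderiv ℝ (fderiv ℝ φ) x v) 0 :=
    h2.comp_hasDerivAt (0 : ℝ) hl
  exact (ContinuousLinearMap.apply ℝ ℝ v).hasFDerivAt.comp_hasDerivAt (0 : ℝ) h3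

/-! ### Test functions touching radial powers from below -/

/-- `x ↦ κ |x - y|^(2β)`. -/
def radialPow (κ β : ℝ) (y x : EucSp N) : ℝ := κ * (‖x - y‖ ^ 2) ^ β

theorem norm_line_sq (w v : EucSp N) (s : ℝ) :
    ‖w + s • v‖ ^ 2 = ‖w‖ ^ 2 + 2 * s * ⟪w, v⟫ + s ^ 2 * ‖v‖ ^ 2 := by
  rw [norm_add_sq_real, inner_smul_right, norm_smul, mul_pow, Real.norm_eq_abs, sq_abs]
  ring

theorem hasDerivAt_line_sq (w v : EucSp N) (s : ℝ) :
    HasDerivAt (fun s : ℝ => ‖w + s • v‖ ^ 2) (2 * ⟪w, v⟫ + 2 * s * ‖v‖ ^ 2) s := by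
  have h := ((((hasDerivAt_id s).const_mul 2).mul_const ⟪w, v⟫).const_add (‖w‖ ^ 2)).add
    (((hasDerivAt_id s).pow 2).mul_const (‖v‖ ^ 2))
  refine (h.congr_of_eventuallyEq (Eventually.of_forall fun s => ?_)).congr_deriv ?_
  · simp [norm_line_sq w v s]
  · simp

theorem hasDerivAt_radialPow_line (κ β : ℝ) (w v : EucSp N) (s : ℝ)
    (hs : ‖w + s • v‖ ^ 2 ≠ 0 ∨ 1 ≤ β) :
    HasDerivAt (fun s : ℝ => κ * (‖w + s • v‖ ^ 2) ^ β)
      (κ * β * (‖w + s • v‖ ^ 2) ^ (β - 1) * (2 * ⟪w, v⟫ + 2 * s * ‖v‖ ^ 2)) s := by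
  refine (((hasDerivAt_line_sq w v s).rpow_const hs).const_mul κ).congr_deriv ?_
  ring

theorem isLocalMin_sub_line {φ g : EucSp N → ℝ} {x₀ : EucSp N}
    (h : ∀ᶠ x in nhds x₀, φ x - φ x₀ ≤ g x - g x₀) (v : EucSp N) :
    IsLocalMin (fun s : ℝ => g (x₀ + s • v) - φ (x₀ + s • v)) 0 := by
  have hc : Tendsto (fun s : ℝ => x₀ + s • v) (nhds 0) (nhds x₀) := by
    have : Continuous fun s : ℝ => x₀ + s • v := by fun_prop
    simpa using this.tendsto 0
  filter_upwards [hc.eventually h] with s hs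
  simp only [zero_smul, add_zero]
  linarith

theorem gradient_eq_of_touch_radialPow {κ β : ℝ} {y x₀ : EucSp N} {φ : EucSp N → ℝ}
    (hφ : ContDiff ℝ 2 φ)
    (h : ∀ᶠ x in nhds x₀, φ x - φ x₀ ≤ radialPow κ β y x - radialPow κ β y x₀)
    (hx : x₀ ≠ y ∨ 1 ≤ β) :
    gradient φ x₀ = (2 * κ * β * (‖x₀ - y‖ ^ 2) ^ (β - 1)) • (x₀ - y) := by
  refine ext_inner_right ℝ fun v => ?_
  have hx' : ‖x₀ - y + (0 : ℝ) • v‖ ^ 2 ≠ 0 ∨ 1 ≤ β := by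
    simpa [sub_eq_zero] using hx
  have hg := hasDerivAt_radialPow_line κ β (x₀ - y) v 0 hx'
  have hd := hg.sub (hasDerivAt_line hφ x₀ v 0)
  have hmin := isLocalMin_sub_line h v
  simp only [radialPow, add_sub_right_comm] at hmin
  have := hmin.hasDerivAt_eq_zero hd
  simp only [zero_smul, add_zero, mul_zero, zero_mul] at this
  rw [inner_gradient_left, real_inner_smul_left]
  linarith

theorem hessian_le_of_touch_radialPow {κ β : ℝ} {y x₀ : EucSp N} {φ : EucSp N → ℝ}
    (hφ : ContDiff ℝ 2 φ)
    (h : ∀ᶠ x in nhds x₀, φ x - φ x₀ ≤ radialPow κ β y x - radialPow κ β y x₀)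
    (hx : x₀ ≠ y) (v : EucSp N) :
    fderiv ℝ (fderiv ℝ φ) x₀ v v ≤ (2 * κ * β * (‖x₀ - y‖ ^ 2) ^ (β - 1)) *
      (‖v‖ ^ 2 + 2 * (β - 1) / ‖x₀ - y‖ ^ 2 * ⟪x₀ - y, v⟫ ^ 2) := by
  have hpos : 0 < ‖x₀ - y‖ ^ 2 := by
    have := norm_pos_iff.2 (sub_ne_zero.2 hx)
    positivity
  have hmin := isLocalMin_sub_line h v
  simp only [radialPow, add_sub_right_comm] at hmin
  have hne : ∀ᶠ s : ℝ in nhds 0, ‖x₀ - y + s • v‖ ^ 2 ≠ 0 := by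
    have hc : ContinuousAt (fun s : ℝ => ‖x₀ - y + s • v‖ ^ 2) 0 := by fun_prop
    exact hc.eventually_ne (by simpa using hpos.ne')
  have h₁ : ∀ᶠ s : ℝ in nhds 0, HasDerivAt
      (fun s : ℝ => κ * (‖x₀ - y + s • v‖ ^ 2) ^ β - φ (x₀ + s • v)) _ s :=
    hne.mono fun s hs => (hasDerivAt_radialPow_line κ β (x₀ - y) v s (Or.inl hs)).sub
      (hasDerivAt_line hφ x₀ v s)
  have hp := (((hasDerivAt_line_sq (x₀ - y) v 0).rpow_const (p := β - 1)
    (Or.inl (by simpa using hpos.ne'))).const_mul (κ * β)).mul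
      (((((hasDerivAt_id (0 : ℝ)).const_mul 2).mul_const (‖v‖ ^ 2))).const_add (2 * ⟪x₀ - y, v⟫))
  have h₂ := hp.sub (hasDerivAt_fderiv_line hφ x₀ v)
  have := hmin.second_deriv_nonneg h₁ h₂
  simp only [zero_smul, add_zero, mul_zero, zero_mul, id_eq, mul_one] at this
  rw [Real.rpow_sub_one hpos.ne' (β - 1)] at this
  refine (sub_nonneg.1 this).trans (le_of_eq ?_)
  field_simp
  ring

/-! ### Consequences of homogeneity and ellipticity -/

theorem H1.apply_zero {Ω : Set (EucSp N)} {F : EucSp N → EucSp N → MatN N → ℝ} {α : ℝ}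
    (hF1 : H1 Ω F α) {x p : EucSp N} (hx : x ∈ Ω) (hp : p ≠ 0) : F x p 0 = 0 := by
  have := hF1 x hx p hp 0 Matrix.isSymm_zero 1 one_ne_zero 0 le_rfl
  simpa using this

theorem H2.mono {Ω : Set (EucSp N)} {F : EucSp N → EucSp N → MatN N → ℝ} {α a A : ℝ}
    (hF2 : H2 Ω F α a A) {x p : EucSp N} (hx : x ∈ Ω) (hp : p ≠ 0) {X Y : MatN N}
    (hX : X.IsSymm) (hY : Y.IsSymm) (hXY : (Y - X).PosSemidef) : F x p X ≤ F x p Y := by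
  have h := (hF2.2.2 x hx p hp X (Y - X) hX (hY.sub hX) hXY).1
  have h0 : 0 ≤ a * ‖p‖ ^ α * (Y - X).trace :=
    mul_nonneg (mul_nonneg hF2.1.le (by positivity)) hXY.trace_nonneg
  rw [add_sub_cancel] at h
  linarith

theorem H2.add_smul_le {Ω : Set (EucSp N)} {F : EucSp N → EucSp N → MatN N → ℝ} {α a A : ℝ}
    (hF2 : H2 Ω F α a A) {x p : EucSp N} (hx : x ∈ Ω) (hp : p ≠ 0) {M P : MatN N}
    (hM : M.IsSymm) (hP : P.IsSymm) (hPp : P.PosSemidef) {s e : ℝ}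
    (hs : 0 ≤ s ∧ e = A ∨ s ≤ 0 ∧ e = a) :
    F x p (M + s • P) ≤ F x p M + e * ‖p‖ ^ α * (s * P.trace) := by
  rcases hs with ⟨hs, rfl⟩ | ⟨hs, rfl⟩
  · have h := (hF2.2.2 x hx p hp M (s • P) hM (hP.smul s) (hPp.smul hs)).2
    rw [Matrix.trace_smul, smul_eq_mul] at h
    linarith
  · have h := (hF2.2.2 x hx p hp (M + s • P) ((-s) • P) (hM.add (hP.smul s)) (hP.smul _)
      (hPp.smul (neg_nonneg.2 hs))).1
    rw [Matrix.trace_smul, smul_eq_mul, neg_smul, add_neg_cancel_right] at h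
    linarith

theorem EucSp.dotProduct_self (w : EucSp N) : (w : Fin N → ℝ) ⬝ᵥ w = ‖w‖ ^ 2 := by
  rw [EuclideanSpace.real_norm_sq_eq]
  simp [dotProduct, sq]

theorem EucSp.dotProduct_eq_inner (w v : EucSp N) : (w : Fin N → ℝ) ⬝ᵥ v = ⟪w, v⟫ := by
  simp [PiLp.inner_apply, dotProduct, mul_comm]

theorem operator_le_of_quadForm_le {Ω : Set (EucSp N)} {F : EucSp N → EucSp N → MatN N → ℝ}
    {α a A : ℝ} (hF1 : H1 Ω F α) (hF2 : H2 Ω F α a A) {x p w : EucSp N} (hx : x ∈ Ω) (hp : p ≠ 0)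
    (hw : w ≠ 0) {X : MatN N} (hX : X.IsSymm) {μ k e : ℝ} (hμ : 0 ≤ μ)
    (hk : 0 ≤ k ∧ e = A ∨ k ≤ 0 ∧ e = a)
    (h : ∀ v : EucSp N, (v : Fin N → ℝ) ⬝ᵥ X.mulVec v ≤
      μ * (‖v‖ ^ 2 + k / ‖w‖ ^ 2 * ⟪w, v⟫ ^ 2)) :
    F x p X ≤ ‖p‖ ^ α * μ * (A * N + k * e) := by
  have hw0 : 0 < ‖w‖ ^ 2 := by
    have := norm_pos_iff.2 hw
    positivity
  set R : MatN N := Matrix.vecMulVec (w : Fin N → ℝ) w with hR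
  have hRp : R.PosSemidef := by
    simpa using Matrix.posSemidef_vecMulVec_self_star (w : Fin N → ℝ)
  have hRs : R.IsSymm := by
    ext i j
    simp [hR, Matrix.vecMulVec_apply, mul_comm]
  have hRt : R.trace = ‖w‖ ^ 2 := by
    rw [hR, Matrix.trace_vecMulVec, EucSp.dotProduct_self]
  have hIs : (μ • (1 : MatN N)).IsSymm := Matrix.isSymm_one.smul μ
  have h1 : F x p (μ • (1 : MatN N)) ≤ A * ‖p‖ ^ α * (μ * N) := by
    have := hF2.add_smul_le hx hp Matrix.isSymm_zero Matrix.isSymm_one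
      (Matrix.PosSemidef.one (n := Fin N) (R := ℝ)) (Or.inl ⟨hμ, rfl⟩)
    simpa [hF1.apply_zero hx hp] using this
  have h2 : F x p (μ • (1 : MatN N) + (μ * (k / ‖w‖ ^ 2)) • R) ≤
      F x p (μ • (1 : MatN N)) + e * ‖p‖ ^ α * (μ * (k / ‖w‖ ^ 2) * R.trace) := by
    refine hF2.add_smul_le hx hp hIs hRs hRp (hk.imp (And.imp_left fun hk => ?_)
      (And.imp_left fun hk => ?_))
    · positivity
    · exact mul_nonpos_of_nonneg_of_nonpos hμ (div_nonpos_of_nonpos_of_nonneg hk hw0.le)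
  have h3 : F x p X ≤ F x p (μ • (1 : MatN N) + (μ * (k / ‖w‖ ^ 2)) • R) := by
    have hYs : (μ • (1 : MatN N) + (μ * (k / ‖w‖ ^ 2)) • R).IsSymm := hIs.add (hRs.smul _)
    refine hF2.mono hx hp hX hYs (Matrix.PosSemidef.of_dotProduct_mulVec_nonneg ?_ fun v => ?_)
    · rw [Matrix.IsHermitian, Matrix.conjTranspose_eq_transpose_of_trivial]
      exact hYs.sub hX
    · have hv := h (WithLp.toLp 2 v)
      have hn := EucSp.dotProduct_self (WithLp.toLp 2 v)
      have hi := EucSp.dotProduct_eq_inner w (WithLp.toLp 2 v)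
      simp only at hv hn hi
      rw [← hn, ← hi] at hv
      simp only [star_trivial, Matrix.sub_mulVec, Matrix.add_mulVec, Matrix.smul_mulVec,
        Matrix.one_mulVec, dotProduct_sub, dotProduct_add, dotProduct_smul, smul_eq_mul, hR,
        Matrix.vecMulVec_mulVec, MulOpposite.smul_eq_mul_unop, MulOpposite.unop_op]
      rw [dotProduct_comm v w.ofLp]
      linarith
  refine h3.trans (h2.trans ((add_le_add_left h1 _).trans (le_of_eq ?_)))
  rw [hRt]
  field_simp

theorem gradTerm_le {h : EucSp N → ℝ → EucSp N} {α H t : ℝ} {x p : EucSp N}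
    (hH : ‖h x t‖ ≤ H) : gradTerm h α x t p ≤ ‖p‖ ^ α * (H * ‖p‖) := by
  rw [gradTerm, mul_comm]
  refine mul_le_mul_of_nonneg_left ((real_inner_le_norm _ _).trans ?_) (by positivity)
  gcongr

theorem operator_le_of_touch_radialPow {Ω : Set (EucSp N)} {T : ℝ}
    {F : EucSp N → EucSp N → MatN N → ℝ} {h : EucSp N → ℝ → EucSp N}
    {α a A H : ℝ} (hF1 : H1 Ω F α) (hF2 : H2 Ω F α a A)
    (hH : ∀ x ∈ Ω, ∀ t ∈ Set.Ioo (0 : ℝ) T, ‖h x t‖ ≤ H)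
    {κ β e : ℝ} (hκβ : 0 < κ * β) (hβ : 1 ≤ β ∧ e = A ∨ β ≤ 1 ∧ e = a)
    {y x₀ : EucSp N} (hx₀ : x₀ ∈ Ω) (hne : x₀ ≠ y) {φ : EucSp N → ℝ} (hφ : ContDiff ℝ 2 φ)
    (htouch : ∀ᶠ x in nhds x₀, φ x - φ x₀ ≤ radialPow κ β y x - radialPow κ β y x₀) :
    ‖gradient φ x₀‖ = 2 * κ * β * (‖x₀ - y‖ ^ 2) ^ (β - 1) * ‖x₀ - y‖ ∧
    ∀ t ∈ Set.Ioo (0 : ℝ) T,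
      F x₀ (gradient φ x₀) (hessMat φ x₀) + gradTerm h α x₀ t (gradient φ x₀) ≤
        ‖gradient φ x₀‖ ^ α * (2 * κ * β * (‖x₀ - y‖ ^ 2) ^ (β - 1)) *
          (A * N + 2 * (β - 1) * e + H * ‖x₀ - y‖) := by
  have hD : 0 < ‖x₀ - y‖ := norm_pos_iff.2 (sub_ne_zero.2 hne)
  have hgrad := gradient_eq_of_touch_radialPow hφ htouch (Or.inl hne)
  set μ := 2 * κ * β * (‖x₀ - y‖ ^ 2) ^ (β - 1) with hμ
  have hμ0 : 0 < μ := by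
    rw [hμ, mul_assoc 2 κ β]
    positivity
  have hnorm : ‖gradient φ x₀‖ = μ * ‖x₀ - y‖ := by
    rw [hgrad, norm_smul, Real.norm_of_nonneg hμ0.le]
  have hp : gradient φ x₀ ≠ 0 := norm_pos_iff.1 (by rw [hnorm]; positivity)
  refine ⟨hnorm, fun t ht => ?_⟩
  have hF := operator_le_of_quadForm_le hF1 hF2 hx₀ hp (sub_ne_zero.2 hne) (hessMat_isSymm hφ x₀)
    (k := 2 * (β - 1)) (e := e) hμ0.le
    (hβ.imp (And.imp_left fun _ => by linarith) (And.imp_left fun _ => by linarith))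
    (fun v => (hessMat_quadForm φ x₀ v).trans_le (hessian_le_of_touch_radialPow hφ htouch hne v))
  have hG := gradTerm_le (α := α) (p := gradient φ x₀) (hH x₀ hx₀ t ht)
  refine (add_le_add hF hG).trans (le_of_eq ?_)
  rw [hnorm]
  ring

/-! ### Pointwise supersolution conditions -/

/-- Every spatial test function with nonzero gradient touching `b` from below at `x₀`, up to an
additive constant, satisfies `F(x₀, ∇φ, D²φ) + h·∇φ|∇φ|^α ≤ B` at all times. -/
def OperatorBoundAt (T : ℝ) (F : EucSp N → EucSp N → MatN N → ℝ) (h : EucSp N → ℝ → EucSp N)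
    (α B : ℝ) (b : EucSp N → ℝ) (x₀ : EucSp N) : Prop :=
  ∀ φ : EucSp N → ℝ, ContDiff ℝ 2 φ → (∀ᶠ x in nhds x₀, φ x - φ x₀ ≤ b x - b x₀) →
    gradient φ x₀ ≠ 0 → ∀ t ∈ Set.Ioo (0 : ℝ) T,
      F x₀ (gradient φ x₀) (hessMat φ x₀) + gradTerm h α x₀ t (gradient φ x₀) ≤ B

/-- The viscosity supersolution condition with right-hand side `m` at `(x₀, t₀)`, where test
functions touch up to an additive constant. -/
def SuperAt (F : EucSp N → EucSp N → MatN N → ℝ) (h : EucSp N → ℝ → EucSp N)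
    (α m : ℝ) (w : EucSp N × ℝ → ℝ) (x₀ : EucSp N) (t₀ : ℝ) : Prop :=
  (∀ φ : EucSp N → ℝ → ℝ, ContDiff ℝ 2 (fun p : EucSp N × ℝ => φ p.1 p.2) →
    (∀ᶠ p : EucSp N × ℝ in nhds (x₀, t₀), φ p.1 p.2 - φ x₀ t₀ ≤ w p - w (x₀, t₀)) →
    gradient (fun x => φ x t₀) x₀ ≠ 0 →
    m ≤ deriv (fun s => φ x₀ s) t₀
          - F x₀ (gradient (fun x => φ x t₀) x₀) (hessMat (fun x => φ x t₀) x₀)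
          - gradTerm h α x₀ t₀ (gradient (fun x => φ x t₀) x₀)) ∧
  (∀ φ : ℝ → ℝ, ContDiff ℝ 2 φ →
    (∀ᶠ p : EucSp N × ℝ in nhds (x₀, t₀), φ p.2 - φ t₀ ≤ w p - w (x₀, t₀)) →
    m ≤ deriv φ t₀)

section Pointwise

variable {Ω : Set (EucSp N)} {T : ℝ} {F : EucSp N → EucSp N → MatN N → ℝ}
  {h : EucSp N → ℝ → EucSp N} {α : ℝ}

theorem OperatorBoundAt.of_le {B : ℝ} {b b' : EucSp N → ℝ} {x₀ : EucSp N}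
    (hb : OperatorBoundAt T F h α B b x₀) (hle : ∀ᶠ x in nhds x₀, b' x ≤ b x)
    (heq : b' x₀ = b x₀) : OperatorBoundAt T F h α B b' x₀ := by
  intro φ hφ htouch
  refine hb φ hφ ?_
  filter_upwards [htouch, hle] with x h1 h2
  linarith

theorem SuperAt.of_le {m : ℝ} {w w' : EucSp N × ℝ → ℝ} {x₀ : EucSp N} {t₀ : ℝ}
    (hw : SuperAt F h α m w x₀ t₀) (hle : ∀ᶠ p in nhds (x₀, t₀), w' p ≤ w p)
    (heq : w' (x₀, t₀) = w (x₀, t₀)) : SuperAt F h α m w' x₀ t₀ := by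
  refine ⟨fun φ hφ ht => hw.1 φ hφ ?_, fun φ hφ ht => hw.2 φ hφ ?_⟩ <;>
  · filter_upwards [ht, hle] with x h1 h2
    linarith

theorem SuperAt.add_const {m : ℝ} {w : EucSp N × ℝ → ℝ} {x₀ : EucSp N} {t₀ : ℝ}
    (hw : SuperAt F h α m w x₀ t₀) (c : ℝ) : SuperAt F h α m (fun p => w p + c) x₀ t₀ := by
  refine ⟨fun φ hφ ht => hw.1 φ hφ ?_, fun φ hφ ht => hw.2 φ hφ ?_⟩ <;>
  · filter_upwards [ht] with x h1
    linarith

theorem deriv_eq_of_sub_le {φ τ : ℝ → ℝ} {τ' t₀ : ℝ} (hφ : Differentiable ℝ φ)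
    (hτ : HasDerivAt τ τ' t₀) (hle : ∀ᶠ t in nhds t₀, φ t - φ t₀ ≤ τ t - τ t₀) :
    deriv φ t₀ = τ' := by
  have hmin : IsLocalMin (τ - φ) t₀ := by
    filter_upwards [hle] with t ht
    simp only [Pi.sub_apply]
    linarith
  have := hmin.hasDerivAt_eq_zero (hτ.sub (hφ t₀).hasDerivAt)
  linarith

theorem superAt_add {B m τ' : ℝ} {b : EucSp N → ℝ} {τ : ℝ → ℝ} {x₀ : EucSp N} {t₀ : ℝ}
    (ht₀ : t₀ ∈ Set.Ioo 0 T) (hb : OperatorBoundAt T F h α B b x₀) (hτ : HasDerivAt τ τ' t₀)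
    (hm : m ≤ τ' - B) (hc : ¬ IsLocalMin b x₀ ∨ m ≤ τ') :
    SuperAt F h α m (fun p => b p.1 + τ p.2) x₀ t₀ := by
  have hsx : Tendsto (fun x : EucSp N => (x, t₀)) (nhds x₀) (nhds (x₀, t₀)) :=
    Continuous.tendsto (by fun_prop) x₀
  have hst : Tendsto (fun t : ℝ => (x₀, t)) (nhds t₀) (nhds (x₀, t₀)) :=
    Continuous.tendsto (by fun_prop) t₀
  refine ⟨fun φ hφ ht hg => ?_, fun φ hφ ht => ?_⟩
  · have h1 : ContDiff ℝ 2 fun x => φ x t₀ :=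
      hφ.comp (contDiff_id.prodMk contDiff_const : ContDiff ℝ 2 fun x : EucSp N => (x, t₀))
    have h2 : ContDiff ℝ 2 fun t => φ x₀ t :=
      hφ.comp (contDiff_const.prodMk contDiff_id : ContDiff ℝ 2 fun t : ℝ => (x₀, t))
    have hop := hb _ h1 ((hsx.eventually ht).mono fun x hx => by
      simpa using hx) hg t₀ ht₀
    have hd := deriv_eq_of_sub_le (h2.differentiable (by norm_num)) hτ
      ((hst.eventually ht).mono fun x hx => by simpa using hx)
    rw [hd]
    linarith
  · have hd := deriv_eq_of_sub_le (hφ.differentiable (by norm_num)) hτ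
      ((hst.eventually ht).mono fun x hx => by simpa using hx)
    rw [hd]
    refine hc.resolve_left fun hc => hc ?_
    filter_upwards [hsx.eventually ht] with x hx
    simpa using hx

theorem lscEnv_eq_of_continuousAt {u : EucSp N → ℝ → ℝ} {x : EucSp N} {t : ℝ}
    (hu : ContinuousAt (fun p : EucSp N × ℝ => u p.1 p.2) (x, t)) : lscEnv u x t = u x t :=
  Tendsto.liminf_eq hu

theorem isSuperSol_of_superAt (hΩ : IsOpen Ω) {m : ℝ} {u : EucSp N → ℝ → ℝ}
    (hu : ContinuousOn (fun p : EucSp N × ℝ => u p.1 p.2) (Ω ×ˢ Set.univ))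
    (hs : ∀ x ∈ Ω, ∀ t ∈ Set.Ioo (0 : ℝ) T, SuperAt F h α m (fun p => u p.1 p.2) x t) :
    IsSuperSol Ω T F h α (fun _ _ => m) u := by
  have henv : ∀ x ∈ Ω, ∀ t, lscEnv u x t = u x t := fun x hx t =>
    lscEnv_eq_of_continuousAt
      (hu.continuousAt ((hΩ.prod isOpen_univ).mem_nhds ⟨hx, Set.mem_univ t⟩))
  intro x₀ hx₀ t₀ ht₀
  have hev : ∀ᶠ p : EucSp N × ℝ in nhds (x₀, t₀), p.1 ∈ Ω :=
    continuous_fst.continuousAt.eventually (hΩ.mem_nhds hx₀)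
  refine ⟨fun φ hφ hle heq hg => (hs x₀ hx₀ t₀ ht₀).1 φ hφ ?_ hg,
    fun δ hδ φ hφ hφ0 hle hinf => (hs x₀ hx₀ t₀ ht₀).2 φ hφ ?_⟩
  · filter_upwards [hle, hev] with p h1 h2
    rw [henv _ h2] at h1
    rw [henv _ hx₀] at heq
    linarith
  · have hI : Set.Ioo (t₀ - δ) (t₀ + δ) ∈ nhds t₀ := Ioo_mem_nhds (by linarith) (by linarith)
    have hx₀inf : u x₀ t₀ ≤
        sInf ((fun t => lscEnv u x₀ t - φ t) '' Set.Ioo (t₀ - δ) (t₀ + δ)) := by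
      refine le_csInf ⟨_, Set.mem_image_of_mem _ (mem_of_mem_nhds hI)⟩ ?_
      rintro _ ⟨t, ht, rfl⟩
      rw [← henv x₀ hx₀ t₀]
      exact hle t ht
    have hbdd : ∀ x ∈ Ω, BddBelow ((fun t => lscEnv u x t - φ t) '' Set.Ioo (t₀ - δ) (t₀ + δ)) := by
      intro x hx
      have hc : Continuous fun t => u x t - φ t := by
        refine Continuous.sub ?_ hφ.continuous
        rw [← continuousOn_univ]
        exact hu.comp (by fun_prop : Continuous fun t : ℝ => (x, t)).continuousOn
          fun t _ => ⟨hx, Set.mem_univ t⟩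
      refine ((isCompact_Icc (a := t₀ - δ) (b := t₀ + δ)).bddBelow_image hc.continuousOn).mono ?_
      simp only [henv x hx]
      exact Set.image_mono Set.Ioo_subset_Icc_self
    have hev' : ∀ᶠ p : EucSp N × ℝ in nhds (x₀, t₀), p.2 ∈ Set.Ioo (t₀ - δ) (t₀ + δ) :=
      continuous_snd.continuousAt.eventually hI
    filter_upwards [hev, hev', continuous_fst.continuousAt.eventually hinf] with p h1 h2 h3
    have h4 := csInf_le (hbdd p.1 h1) (Set.mem_image_of_mem _ h2)
    rw [h3] at h4
    simp only [henv _ h1] at h4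
    rw [hφ0]
    linarith

end Pointwise

/-! ### Infima of families of barriers -/

/-- An infimum of countably many functions, locally finite away from the compact set `Γ`, which
attains prescribed boundary values on `Γ`. -/
theorem exists_inf_of_barriers {X : Type*} [MetricSpace X] {Q Γ : Set X} (hΓ : IsCompact Γ)
    (hΓQ : Γ ⊆ Q) (hne : Γ.Nonempty) {ψ : X → ℝ} (hψ : ContinuousOn ψ Q) (P : (X → ℝ) → Prop)
    (hP : ∀ p ∈ Γ, ∀ ε > 0, ∀ M : ℝ, ∃ w : X → ℝ, P w ∧ ContinuousOn w Q ∧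
      (∀ q ∈ Q, ψ q ≤ w q) ∧ w p < ψ p + ε ∧ ∀ q ∈ Q, ε ≤ dist q p → M ≤ w q) :
    ∃ W : X → ℝ, ContinuousOn W Q ∧ (∀ q ∈ Q, ψ q ≤ W q) ∧ (∀ q ∈ Γ, W q = ψ q) ∧
      ∀ q ∈ Q, q ∉ Γ → ∃ w, P w ∧ W q = w q ∧ ∀ q' ∈ Q, W q' ≤ w q' := by
  have hpos : ∀ n : ℕ, (0 : ℝ) < 1 / (n + 1) := fun n => Nat.one_div_pos_of_nat
  choose! w hwP hwc hwψ hwp hwM using fun (n : ℕ) (p : X) (hp : p ∈ Γ) => hP p hp _ (hpos n) n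
  have hcov : ∀ n : ℕ, ∃ t : Finset X, (∀ p ∈ t, p ∈ Γ) ∧
      Γ ⊆ ⋃ p ∈ t, {q | w n p q < ψ q + 1 / (n + 1)} := fun n => by
    refine hΓ.elim_nhdsWithin_subcover _ fun p hp => ?_
    exact ((hwc n p hp).mono hΓQ p hp).eventually_lt
      (((hψ.mono hΓQ) p hp).add continuousWithinAt_const) (hwp n p hp)
  choose t htΓ htcov using hcov
  set S : Set (X → ℝ) := {g | ∃ n, ∃ p ∈ t n, g = w n p} with hS
  have hSP : ∀ g ∈ S, P g ∧ ContinuousOn g Q ∧ ∀ q ∈ Q, ψ q ≤ g q := by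
    rintro g ⟨n, p, hp, rfl⟩
    exact ⟨hwP n p (htΓ n p hp), hwc n p (htΓ n p hp), hwψ n p (htΓ n p hp)⟩
  have hSne : S.Nonempty := by
    obtain ⟨q, hq⟩ := hne
    obtain ⟨p, hp, -⟩ := Set.mem_iUnion₂.1 (htcov 0 hq)
    exact ⟨_, 0, p, hp, rfl⟩
  have hbdd : ∀ q ∈ Q, BddBelow ((fun g : X → ℝ => g q) '' S) := by
    rintro q hq
    refine ⟨ψ q, ?_⟩
    rintro _ ⟨g, hg, rfl⟩
    exact (hSP g hg).2.2 q hq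
  have hWle : ∀ q ∈ Q, ∀ g ∈ S, sInf ((fun g : X → ℝ => g q) '' S) ≤ g q := fun q hq g hg =>
    csInf_le (hbdd q hq) (Set.mem_image_of_mem _ hg)
  have hleW : ∀ q c, (∀ g ∈ S, c ≤ g q) → c ≤ sInf ((fun g : X → ℝ => g q) '' S) := by
    intro q c hc
    refine le_csInf (hSne.image _) ?_
    rintro _ ⟨g, hg, rfl⟩
    exact hc g hg
  have hltW : ∀ q c, sInf ((fun g : X → ℝ => g q) '' S) < c → ∃ g ∈ S, g q < c := by
    intro q c hc
    obtain ⟨_, ⟨g, hg, rfl⟩, h⟩ := exists_lt_of_csInf_lt (hSne.image _) hc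
    exact ⟨g, hg, h⟩
  have hfin : ∀ q ∉ Γ, ∀ C : ℝ, ∃ S₀ : Set (X → ℝ), S₀.Finite ∧ S₀ ⊆ S ∧
      ∀ᶠ q' in nhds q, q' ∈ Q → ∀ g ∈ S, g ∉ S₀ → C ≤ g q' := by
    intro q hq C
    have hr : 0 < infDist q Γ := (hΓ.isClosed.notMem_iff_infDist_pos hne).1 hq
    obtain ⟨n₁, hn₁⟩ := exists_nat_one_div_lt (half_pos hr)
    obtain ⟨n₂, hn₂⟩ := exists_nat_ge C
    refine ⟨⋃ n ∈ Finset.range (max n₁ n₂), (fun p => w n p) '' (t n : Set X),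
      (Finset.range _).finite_toSet.biUnion fun n _ => (t n).finite_toSet.image _, ?_, ?_⟩
    · rintro g hg
      obtain ⟨n, -, p, hp, rfl⟩ := Set.mem_iUnion₂.1 hg
      exact ⟨n, p, hp, rfl⟩
    · filter_upwards [ball_mem_nhds q (half_pos hr)] with q' hq' hq'Q g hg hgS
      obtain ⟨n, p, hp, rfl⟩ := hg
      have hn : max n₁ n₂ ≤ n := by
        by_contra! hlt
        exact hgS (Set.mem_iUnion₂.2 ⟨n, Finset.mem_range.2 hlt, p, hp, rfl⟩)
      have h1 : C ≤ n := hn₂.trans (by exact_mod_cast (le_max_right _ _).trans hn)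
      refine h1.trans (hwM n p (htΓ n p hp) q' hq'Q ?_)
      have h2 : infDist q Γ ≤ dist q p := infDist_le_dist_of_mem (htΓ n p hp)
      have h3 := dist_triangle q q' p
      rw [mem_ball, dist_comm] at hq'
      have h4 : (1 : ℝ) / (n + 1) ≤ 1 / (n₁ + 1) := by
        apply Nat.one_div_le_one_div ((le_max_left _ _).trans hn)
      linarith
  have hΓW : ∀ q ∈ Γ, sInf ((fun g : X → ℝ => g q) '' S) = ψ q := by
    intro q hq
    refine le_antisymm (le_of_forall_pos_lt_add fun ε hε => ?_)
      (hleW q _ fun g hg => (hSP g hg).2.2 q (hΓQ hq))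
    obtain ⟨n, hn⟩ := exists_nat_one_div_lt hε
    obtain ⟨p, hp, hlt⟩ := Set.mem_iUnion₂.1 (htcov n hq)
    have hlt' : w n p q < ψ q + 1 / (n + 1) := hlt
    linarith [hWle q (hΓQ hq) _ ⟨n, p, hp, rfl⟩]
  refine ⟨fun q => sInf ((fun g : X → ℝ => g q) '' S), fun q hq => ?_,
    fun q hq => hleW q _ fun g hg => (hSP g hg).2.2 q hq, hΓW, fun q hq hqΓ => ?_⟩
  · refine tendsto_order.2 ⟨fun c hc => ?_, fun c hc => ?_⟩
    · beta_reduce at hc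
      by_cases hqΓ : q ∈ Γ
      · rw [hΓW q hqΓ] at hc
        filter_upwards [(hψ q hq).eventually_const_lt hc, self_mem_nhdsWithin] with q' h1 h2
        exact h1.trans_le (hleW _ _ fun g hg => (hSP g hg).2.2 _ h2)
      · obtain ⟨c', hcc', hc'⟩ := exists_between hc
        obtain ⟨S₀, hS₀, hS₀S, hS₀ev⟩ := hfin q hqΓ c'
        have hev : ∀ᶠ q' in nhdsWithin q Q, ∀ g ∈ S₀, c' < g q' :=
          (hS₀.eventually_all).2 fun g hg =>
            ((hSP g (hS₀S hg)).2.1 q hq).eventually_const_lt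
              (hc'.trans_le (hWle q hq g (hS₀S hg)))
        filter_upwards [hev, mem_nhdsWithin_of_mem_nhds hS₀ev, self_mem_nhdsWithin]
          with q' h1 h2 h3
        refine hcc'.trans_le (hleW _ _ fun g hg => ?_)
        by_cases hgS₀ : g ∈ S₀
        · exact (h1 g hgS₀).le
        · exact h2 h3 g hg hgS₀
    · obtain ⟨g, hg, hgc⟩ := hltW q c hc
      filter_upwards [((hSP g hg).2.1 q hq).eventually_lt_const hgc, self_mem_nhdsWithin]
        with q' h1 h2
      exact (hWle _ h2 g hg).trans_lt h1
  · obtain ⟨S₀, hS₀, hS₀S, hS₀ev⟩ := hfin q hqΓ (sInf ((fun g : X → ℝ => g q) '' S) + 1)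
    have hfar := hS₀ev.self_of_nhds hq
    obtain ⟨g₀, hg₀, hg₀lt⟩ := hltW q _ (lt_add_one _)
    have hg₀S : g₀ ∈ S₀ := by
      by_contra hcon
      exact absurd (hfar g₀ hg₀ hcon) (not_le.2 hg₀lt)
    obtain ⟨g, hg, hmin⟩ := hS₀.exists_minimalFor (fun g : X → ℝ => g q) _ ⟨g₀, hg₀S⟩
    have hmin' : ∀ g' ∈ S₀, g q ≤ g' q := fun g' hg' =>
      (le_total (g q) (g' q)).elim id fun hle => hmin hg' hle
    refine ⟨g, (hSP g (hS₀S hg)).1, le_antisymm (hWle q hq g (hS₀S hg)) (hleW q _ fun g' hg' => ?_),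
      fun q' hq' => hWle q' hq' g (hS₀S hg)⟩
    by_cases hcon : g' ∈ S₀
    · exact hmin' g' hcon
    · exact (hmin' g₀ hg₀S).trans (hg₀lt.le.trans (hfar g' hg' hcon))

/-! ### Barriers at the initial time -/

theorem operatorBoundAt_radialPow_of_one_le {Ω : Set (EucSp N)} {T : ℝ}
    {F : EucSp N → EucSp N → MatN N → ℝ} {h : EucSp N → ℝ → EucSp N} {α a A H : ℝ}
    (hα : -1 < α) (hF1 : H1 Ω F α) (hF2 : H2 Ω F α a A) (hH0 : 0 ≤ H)
    (hH : ∀ x ∈ Ω, ∀ t ∈ Set.Ioo (0 : ℝ) T, ‖h x t‖ ≤ H) {C β D : ℝ} (hC : 0 < C)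
    (hβ : β = 1 + 1 / (2 * (1 + α))) {y x₀ : EucSp N} (hx₀ : x₀ ∈ Ω) (hD : ‖x₀ - y‖ ≤ D) :
    OperatorBoundAt T F h α
      ((2 * C * β * D) ^ (1 + α) * (A * N + 2 * (β - 1) * A + H * D)) (radialPow C β y) x₀ := by
  intro φ hφ htouch hg t ht
  have hα1 : 0 < 1 + α := by linarith
  have hβ1 : 1 < β := by
    rw [hβ]
    have : 0 < 1 / (2 * (1 + α)) := by positivity
    linarith
  have hA : 0 < A := hF2.1.trans_le hF2.2.1
  have hne : x₀ ≠ y := by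
    rintro rfl
    exact hg (by simpa using gradient_eq_of_touch_radialPow hφ htouch (Or.inr hβ1.le))
  have hd : 0 < ‖x₀ - y‖ := norm_pos_iff.2 (sub_ne_zero.2 hne)
  obtain ⟨hnorm, hop⟩ := operator_le_of_touch_radialPow hF1 hF2 hH (by positivity)
    (Or.inl ⟨hβ1.le, rfl⟩) hx₀ hne hφ htouch
  refine (hop t ht).trans ?_
  have hpow : (‖x₀ - y‖ ^ 2) ^ (β - 1) = ‖x₀ - y‖ ^ (1 / (1 + α)) := by
    rw [← Real.rpow_natCast, ← Real.rpow_mul hd.le, hβ]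
    congr 1
    push_cast
    field_simp
    ring
  have hkey : ‖gradient φ x₀‖ ^ α * (2 * C * β * (‖x₀ - y‖ ^ 2) ^ (β - 1)) =
      (2 * C * β * ‖x₀ - y‖) ^ (1 + α) := by
    rw [hnorm, hpow, Real.mul_rpow (by positivity) hd.le,
      Real.mul_rpow (by positivity) (by positivity), ← Real.rpow_mul hd.le,
      Real.mul_rpow (x := 2 * C * β) (by positivity) hd.le, Real.rpow_add (by positivity) 1 α,
      Real.rpow_one, Real.rpow_add hd 1 α, Real.rpow_one]
    have h1 : ‖x₀ - y‖ ^ (1 / (1 + α) * α) * ‖x₀ - y‖ ^ (1 / (1 + α)) = ‖x₀ - y‖ := by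
      rw [← Real.rpow_add hd]
      have : 1 / (1 + α) * α + 1 / (1 + α) = 1 := by
        field_simp
        ring
      rw [this, Real.rpow_one]
    calc _ = (2 * C * β) ^ α * (2 * C * β) * ‖x₀ - y‖ ^ α *
          (‖x₀ - y‖ ^ (1 / (1 + α) * α) * ‖x₀ - y‖ ^ (1 / (1 + α))) := by ring
      _ = _ := by rw [h1]; ring
  rw [hkey]
  have hβ0 : 0 ≤ β - 1 := by linarith
  have hD0 : 0 < D := hd.trans_le hD
  gcongr

theorem exists_initial_barrier {Ω : Set (EucSp N)} {T : ℝ}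
    {F : EucSp N → EucSp N → MatN N → ℝ} {h : EucSp N → ℝ → EucSp N} {α a A H : ℝ}
    (hα : -1 < α) (hΩb : Bornology.IsBounded Ω) (hF1 : H1 Ω F α) (hF2 : H2 Ω F α a A) (hH0 : 0 ≤ H)
    (hH : ∀ x ∈ Ω, ∀ t ∈ Set.Ioo (0 : ℝ) T, ‖h x t‖ ≤ H) (m : ℝ) (y : EucSp N) {δ : ℝ}
    (hδ : 0 < δ) (M : ℝ) :
    ∃ b : EucSp N × ℝ → ℝ, Continuous b ∧ b (y, 0) = 0 ∧ (∀ q, 0 ≤ q.2 → 0 ≤ b q) ∧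
      (∀ q, 0 ≤ q.2 → δ ≤ dist q (y, 0) → M ≤ b q) ∧
      ∀ x ∈ Ω, ∀ t ∈ Set.Ioo (0 : ℝ) T, SuperAt F h α m b x t := by
  obtain ⟨D, hD⟩ := hΩb.subset_closedBall y
  set β : ℝ := 1 + 1 / (2 * (1 + α)) with hβ
  have hα1 : 0 < 1 + α := by linarith
  have hβ1 : 1 < β := by
    rw [hβ]
    have : 0 < 1 / (2 * (1 + α)) := by positivity
    linarith
  set C : ℝ := |M| / (δ ^ 2) ^ β + 1 with hC
  have hC0 : 0 < C := by positivity
  set B : ℝ := (2 * C * β * D) ^ (1 + α) * (A * N + 2 * (β - 1) * A + H * D) with hB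
  set L : ℝ := |M| / δ + |m| + |B| with hL
  have hL0 : 0 ≤ L := by positivity
  have hrad : ∀ x, 0 ≤ radialPow C β y x := fun x => by
    rw [radialPow]
    positivity
  refine ⟨fun q => radialPow C β y q.1 + L * q.2, ?_, ?_, fun q hq => ?_, fun q hq hdist => ?_,
    fun x hx t ht => ?_⟩
  · have : Continuous fun q : EucSp N × ℝ => (‖q.1 - y‖ ^ 2) ^ β :=
      Continuous.rpow_const (by fun_prop) fun _ => Or.inr (by linarith)
    simp only [radialPow]
    fun_prop
  · simp [radialPow, Real.zero_rpow (by linarith : β ≠ 0)]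
  · exact add_nonneg (hrad _) (mul_nonneg hL0 hq)
  · have hδβ : 0 < (δ ^ 2) ^ β := by positivity
    refine (le_abs_self M).trans ?_
    rcases le_max_iff.1 (Prod.dist_eq (α := EucSp N) (β := ℝ) ▸ hdist) with hx | ht
    · rw [dist_eq_norm] at hx
      have h1 : (δ ^ 2) ^ β ≤ (‖q.1 - y‖ ^ 2) ^ β := by gcongr
      have h2 : |M| ≤ radialPow C β y q.1 := by
        calc |M| = |M| / (δ ^ 2) ^ β * (δ ^ 2) ^ β := by field_simp
          _ ≤ C * (δ ^ 2) ^ β := by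
            gcongr
            rw [hC]
            linarith
          _ ≤ _ := by
            rw [radialPow]
            gcongr
      have := mul_nonneg hL0 hq
      linarith
    · rw [Real.dist_eq, sub_zero, abs_of_nonneg hq] at ht
      have h2 : |M| ≤ L * q.2 := by
        calc |M| = |M| / δ * δ := by field_simp
          _ ≤ L * q.2 := by
            gcongr
            rw [hL]
            linarith [abs_nonneg m, abs_nonneg B]
      linarith [hrad q.1]
  · have hMδ : 0 ≤ |M| / δ := by positivity
    refine superAt_add (B := B) ht ?_ (((hasDerivAt_id t).const_mul L).congr_deriv (mul_one L)) ?_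
      (Or.inr ?_)
    · exact operatorBoundAt_radialPow_of_one_le hα hF1 hF2 hH0 hH hC0 hβ hx
        (by simpa [dist_eq_norm] using hD hx)
    · linarith [le_abs_self m, le_abs_self B]
    · linarith [le_abs_self m, abs_nonneg B]

/-! ### Barriers on the lateral boundary -/

theorem UnifExtCone.exists_exterior_ball {Ω : Set (EucSp N)} (hcone : UnifExtCone Ω) :
    ∃ κ ∈ Set.Ioo (0 : ℝ) 1, ∃ s₁ > 0, ∀ z ∈ frontier Ω, ∀ s ∈ Set.Ioo 0 s₁,
      ∃ y : EucSp N, ‖z - y‖ = s ∧ ∀ x ∈ closure Ω, κ * s ≤ ‖x - y‖ := by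
  obtain ⟨φ₀, hφ₀, r, hr, hz⟩ := hcone
  have hc1 : -1 < Real.cos φ₀ := by
    rw [← Real.cos_pi]
    exact Real.cos_lt_cos_of_nonneg_of_le_pi hφ₀.1.le le_rfl hφ₀.2
  have hc2 := Real.cos_le_one φ₀
  set κ := (1 + Real.cos φ₀) / 4 with hκ
  have hκ0 : 0 < κ := by linarith
  have hκ1 : κ ≤ 1 / 2 := by linarith
  refine ⟨κ, ⟨hκ0, by linarith⟩, r / 2, by positivity, fun z hzf s hs => ?_⟩
  obtain ⟨n, hn, hcap⟩ := hz z hzf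
  refine ⟨z - s • n, by simp [norm_smul, hn, abs_of_pos hs.1], fun x hx => ?_⟩
  by_contra! hlt
  set e := x - (z - s • n) with he
  have hxz : x - z = e - s • n := by
    rw [he]
    abel
  have hnorm : ‖x - z‖ ≤ (1 + κ) * s := by
    rw [hxz]
    refine (norm_sub_le _ _).trans ?_
    rw [norm_smul, hn, Real.norm_of_nonneg hs.1.le]
    linarith
  have hκs : κ * s ≤ s / 2 := by nlinarith [hs.1]
  have hinner : ⟪x - z, n⟫ ≤ -(1 - κ) * s := by
    rw [hxz, inner_sub_left, real_inner_smul_left, real_inner_self_eq_norm_sq, hn]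
    have := real_inner_le_norm e n
    rw [hn] at this
    linarith
  have hmem : x ∈ ({z} : Set (EucSp N)) := by
    rw [← hcap]
    refine ⟨⟨?_, hx⟩, ?_⟩
    · show ⟪x - z, n⟫ ≤ Real.cos φ₀ * ‖x - z‖
      refine hinner.trans ?_
      rcases le_total 0 (Real.cos φ₀) with h0 | h0
      · have := mul_nonneg h0 (norm_nonneg (x - z))
        nlinarith [hs.1]
      · have h1 := mul_le_mul_of_nonpos_left hnorm h0
        have h2 : Real.cos φ₀ = 4 * κ - 1 := by linarith
        rw [h2] at h1 ⊢
        nlinarith [hs.1, mul_pos hκ0 hs.1, mul_pos (mul_pos hκ0 hκ0) hs.1]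
    · rw [mem_ball, dist_eq_norm]
      have := hs.2
      linarith
  rw [Set.mem_singleton_iff] at hmem
  have hes : e = s • n := by
    rw [he, hmem]
    abel
  rw [hes, norm_smul, hn, Real.norm_of_nonneg hs.1.le] at hlt
  linarith [hs.1]

theorem operatorBoundAt_radialPow_neg {Ω : Set (EucSp N)} {T : ℝ}
    {F : EucSp N → EucSp N → MatN N → ℝ} {h : EucSp N → ℝ → EucSp N} {α a A H : ℝ}
    (hα : -1 < α) (hF1 : H1 Ω F α) (hF2 : H2 Ω F α a A) (hH0 : 0 ≤ H)
    (hH : ∀ x ∈ Ω, ∀ t ∈ Set.Ioo (0 : ℝ) T, ‖h x t‖ ≤ H) {B c d σ D : ℝ} (hB : 0 ≤ B) (hd : 0 < d)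
    (hσ : 0 < σ) (hσD : A * N - a * (σ + 2) + H * D ≤ -1)
    {y x₀ : EucSp N} (hx₀ : x₀ ∈ Ω) (hne : x₀ ≠ y) (hD : ‖x₀ - y‖ ≤ D)
    (hBD : B * D ≤ (d * σ * D ^ (-σ - 1)) ^ (1 + α)) :
    OperatorBoundAt T F h α (-B) (fun x => c + radialPow (-d) (-(σ / 2)) y x) x₀ ∧
      ¬ IsLocalMin (fun x => c + radialPow (-d) (-(σ / 2)) y x) x₀ := by
  have hr : 0 < ‖x₀ - y‖ := norm_pos_iff.2 (sub_ne_zero.2 hne)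
  have hα1 : 0 < 1 + α := by linarith
  have hκβ : 0 < -d * -(σ / 2) := by
    rw [neg_mul_neg]
    positivity
  have htest : ∀ φ : EucSp N → ℝ, ContDiff ℝ 2 φ →
      (∀ᶠ x in nhds x₀, φ x - φ x₀ ≤ c + radialPow (-d) (-(σ / 2)) y x -
        (c + radialPow (-d) (-(σ / 2)) y x₀)) → _ := fun φ hφ htouch =>
    operator_le_of_touch_radialPow hF1 hF2 hH hκβ (Or.inr ⟨by linarith, rfl⟩) hx₀ hne hφ
      (by simpa only [add_sub_add_left_eq_sub] using htouch)
  have hμ : 2 * -d * -(σ / 2) * (‖x₀ - y‖ ^ 2) ^ (-(σ / 2) - 1) * ‖x₀ - y‖ =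
      d * σ * ‖x₀ - y‖ ^ (-σ - 1) := by
    have : (‖x₀ - y‖ ^ 2) ^ (-(σ / 2) - 1) = ‖x₀ - y‖ ^ (-σ - 1 - 1) := by
      rw [← Real.rpow_natCast, ← Real.rpow_mul hr.le]
      congr 1
      push_cast
      ring
    rw [this, Real.rpow_sub_one hr.ne' (-σ - 1)]
    field_simp
  refine ⟨fun φ hφ htouch hg t ht => ?_, fun hmin => ?_⟩
  · obtain ⟨hnorm, hop⟩ := htest φ hφ htouch
    refine (hop t ht).trans ?_
    rw [hμ] at hnorm
    set p := ‖gradient φ x₀‖ with hp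
    have hp0 : 0 < p := by
      rw [hnorm]
      positivity
    have hpow : p ^ α * (2 * -d * -(σ / 2) * (‖x₀ - y‖ ^ 2) ^ (-(σ / 2) - 1)) =
        p ^ (1 + α) / ‖x₀ - y‖ := by
      rw [eq_div_iff hr.ne', mul_assoc, hμ, ← hnorm, add_comm, Real.rpow_add hp0, Real.rpow_one]
    have hpB : B * ‖x₀ - y‖ ≤ p ^ (1 + α) := by
      have h1 : d * σ * D ^ (-σ - 1) ≤ p := by
        rw [hnorm]
        gcongr 1
        exact Real.rpow_le_rpow_of_nonpos hr hD (by linarith)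
      have hD0 : 0 < D := hr.trans_le hD
      calc B * ‖x₀ - y‖ ≤ B * D := by gcongr
        _ ≤ _ := hBD
        _ ≤ p ^ (1 + α) := by gcongr
    have hB' : B ≤ p ^ (1 + α) / ‖x₀ - y‖ := (le_div_iff₀ hr).2 hpB
    have hneg : A * N + 2 * (-(σ / 2) - 1) * a + H * ‖x₀ - y‖ ≤ -1 := by
      have := mul_le_mul_of_nonneg_left hD hH0
      linarith
    rw [hpow]
    nlinarith
  · obtain ⟨hnorm, -⟩ := htest (fun _ => 0) contDiff_const
      (hmin.mono fun x hx => by simpa using hx)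
    rw [hμ, gradient_fun_const, norm_zero] at hnorm
    have : 0 < d * σ * ‖x₀ - y‖ ^ (-σ - 1) := by positivity
    linarith

/-- A stationary barrier on `Ω`: nonnegative and continuous up to the boundary, without interior
local minima, and satisfying `F(x, ∇b, D²b) + h·∇b|∇b|^α ≤ -B` in the viscosity sense. -/
structure IsLateralBarrier (Ω : Set (EucSp N)) (T : ℝ) (F : EucSp N → EucSp N → MatN N → ℝ)
    (h : EucSp N → ℝ → EucSp N) (α B : ℝ) (b : EucSp N → ℝ) : Prop where
  continuousOn : ContinuousOn b (closure Ω)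
  nonneg : ∀ x ∈ closure Ω, 0 ≤ b x
  operator : ∀ x ∈ Ω, OperatorBoundAt T F h α (-B) b x
  not_isLocalMin : ∀ x ∈ Ω, ¬ IsLocalMin b x

section Lateral

variable {Ω : Set (EucSp N)} {T : ℝ} {F : EucSp N → EucSp N → MatN N → ℝ}
  {h : EucSp N → ℝ → EucSp N} {α a A H B : ℝ}

theorem radialPow_neg_eq {c k σ : ℝ} (hk : 0 < k) {x y : EucSp N} (hxy : 0 < ‖x - y‖) :
    c + radialPow (-(c * k ^ σ)) (-(σ / 2)) y x = c * (1 - (k / ‖x - y‖) ^ σ) := by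
  have h1 : (‖x - y‖ ^ 2) ^ (-(σ / 2)) = (‖x - y‖ ^ σ)⁻¹ := by
    rw [← Real.rpow_natCast, ← Real.rpow_mul hxy.le, ← Real.rpow_neg hxy.le]
    congr 1
    push_cast
    ring
  rw [radialPow, h1, Real.div_rpow hk.le hxy.le]
  ring

theorem continuousOn_radialPow {c d β : ℝ} {y : EucSp N} {s : Set (EucSp N)} (hy : y ∉ s) :
    ContinuousOn (fun x => c + radialPow d β y x) s := by
  refine continuousOn_const.add (continuousOn_const.mul (ContinuousOn.rpow_const
    (by fun_prop) fun x hx => Or.inl ?_))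
  have : x ≠ y := fun hxy => hy (hxy ▸ hx)
  have : 0 < ‖x - y‖ := norm_pos_iff.2 (sub_ne_zero.2 this)
  positivity

theorem IsLateralBarrier.exists_improvement (hα : -1 < α) (hF1 : H1 Ω F α) (hF2 : H2 Ω F α a A)
    (hH0 : 0 ≤ H) (hH : ∀ x ∈ Ω, ∀ t ∈ Set.Ioo (0 : ℝ) T, ‖h x t‖ ≤ H) (hB : 0 ≤ B)
    {z : EucSp N} (hz : z ∈ closure Ω) {κ s₁ σ : ℝ} (hκ : κ ∈ Set.Ioo (0 : ℝ) 1) (hs₁ : 0 < s₁)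
    (hball : ∀ s ∈ Set.Ioo 0 s₁, ∃ y : EucSp N, ‖z - y‖ = s ∧ ∀ x ∈ closure Ω, κ * s ≤ ‖x - y‖)
    (hσ : 0 < σ) (hσ4 : A * N - a * (σ + 2) + H * 4 ≤ -1) {b : EucSp N → ℝ}
    (hb : IsLateralBarrier Ω T F h α B b) {η δ : ℝ} (hη : b z < η) (hδ : 0 < δ) :
    ∃ b', IsLateralBarrier Ω T F h α B b' ∧ b' z ≤ (1 - κ ^ σ) / (1 - (κ / 2) ^ σ) * η ∧
      ∀ x ∈ closure Ω, δ ≤ ‖x - z‖ → b' x = b x := by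
  have hη0 : 0 < η := (hb.nonneg z hz).trans_lt hη
  have hκ0 := hκ.1
  have hq : 0 < 1 - (κ / 2) ^ σ := by
    have : (κ / 2) ^ σ < 1 := Real.rpow_lt_one (by positivity) (by linarith [hκ.2]) hσ
    linarith
  obtain ⟨r, hr, hrb⟩ := Metric.mem_nhdsWithin_iff.1
    ((hb.continuousOn z hz).eventually_lt_const hη)
  set c := η / (1 - (κ / 2) ^ σ) with hc
  have hc0 : 0 < c := by positivity
  set E := c * κ ^ σ * σ * 4 ^ (-σ - 1) with hE
  have hE0 : 0 < E := by positivity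
  have hev : ∀ᶠ s in nhdsWithin (0 : ℝ) (Set.Ioi 0), 4 * B ≤ (E / s) ^ (1 + α) := by
    have h1 : Tendsto (fun s : ℝ => (E / s) ^ (1 + α)) (nhdsWithin 0 (Set.Ioi 0)) atTop :=
      (tendsto_rpow_atTop (by linarith)).comp
        ((tendsto_inv_nhdsGT_zero.const_mul_atTop hE0).congr fun s => rfl)
    exact h1.eventually_ge_atTop _
  have hev' : ∀ e > (0 : ℝ), ∀ᶠ s in nhdsWithin (0 : ℝ) (Set.Ioi 0), s < e := fun e he =>
    mem_nhdsWithin_of_mem_nhds (Iio_mem_nhds he)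
  obtain ⟨s, hsB, hss₁, hs1, hsδ, hsr, hs0⟩ := (hev.and ((hev' s₁ hs₁).and ((hev' 1 one_pos).and
    ((hev' (δ / 3) (by positivity)).and ((hev' (r / 3) (by positivity)).and
      self_mem_nhdsWithin))))).exists
  replace hs0 : 0 < s := hs0
  obtain ⟨y, hzy, hy⟩ := hball s ⟨hs0, hss₁⟩
  have hκs : 0 < κ * s := by positivity
  have hpos : ∀ x ∈ closure Ω, 0 < ‖x - y‖ := fun x hx => hκs.trans_le (hy x hx)
  have hyΩ : y ∉ closure Ω := fun hmem => by simpa using hpos y hmem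
  set g : EucSp N → ℝ := fun x => c + radialPow (-(c * (κ * s) ^ σ)) (-(σ / 2)) y x with hg
  have hgeq : ∀ x ∈ closure Ω, g x = c * (1 - (κ * s / ‖x - y‖) ^ σ) := fun x hx =>
    radialPow_neg_eq hκs (hpos x hx)
  have hgc : ContinuousOn g (closure Ω) := continuousOn_radialPow hyΩ
  have hg0 : ∀ x ∈ closure Ω, 0 ≤ g x := fun x hx => by
    rw [hgeq x hx]
    have : (κ * s / ‖x - y‖) ^ σ ≤ 1 := Real.rpow_le_one (by positivity)
      ((div_le_one (hpos x hx)).2 (hy x hx)) hσ.le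
    exact mul_nonneg hc0.le (by linarith)
  have hgη : ∀ x ∈ closure Ω, 3 * s ≤ ‖x - z‖ → η ≤ g x := fun x hx hxz => by
    have h2s : 2 * s ≤ ‖x - y‖ := by
      have := norm_add_le (x - y) (y - z)
      rw [sub_add_sub_cancel, norm_sub_rev y z, hzy] at this
      linarith
    rw [hgeq x hx]
    have h1 : κ * s / ‖x - y‖ ≤ κ / 2 := by
      rw [div_le_div_iff₀ (hpos x hx) two_pos]
      nlinarith
    have h2 : (κ * s / ‖x - y‖) ^ σ ≤ (κ / 2) ^ σ := by gcongr
    calc η = c * (1 - (κ / 2) ^ σ) := by rw [hc]; field_simp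
      _ ≤ _ := by gcongr
  have hgop : ∀ x ∈ Ω, ‖x - z‖ < 3 * s → OperatorBoundAt T F h α (-B) g x ∧
      ¬ IsLocalMin g x := fun x hx hxz => by
    have hxy : ‖x - y‖ ≤ 4 * s := by
      have := norm_add_le (x - z) (z - y)
      rw [sub_add_sub_cancel, hzy] at this
      linarith
    refine operatorBoundAt_radialPow_neg (D := 4 * s) hα hF1 hF2 hH0 hH hB (by positivity) hσ ?_ hx
      (fun hxy => hyΩ (hxy ▸ subset_closure hx)) hxy ?_
    · nlinarith
    · have h1 : c * (κ * s) ^ σ * σ * (4 * s) ^ (-σ - 1) = E / s := by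
        rw [hE, Real.mul_rpow hκ0.le hs0.le, Real.mul_rpow (by norm_num) hs0.le,
          Real.rpow_sub_one hs0.ne', Real.rpow_neg hs0.le]
        field_simp
      rw [h1]
      refine le_trans ?_ hsB
      nlinarith
  set b' : EucSp N → ℝ := fun x => if ‖x - z‖ < 3 * s then min (b x) (g x) else b x with hb'
  have hle : ∀ x, b' x ≤ b x := fun x => by
    simp only [hb']
    split_ifs
    exacts [min_le_left _ _, le_rfl]
  have hop : ∀ x ∈ Ω, OperatorBoundAt T F h α (-B) b' x ∧ ¬ IsLocalMin b' x := by
    have hmin : ∀ x, ∀ g' : EucSp N → ℝ, (∀ᶠ x' in nhds x, b' x' ≤ g' x') → b' x = g' x →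
        ¬ IsLocalMin g' x → ¬ IsLocalMin b' x := fun x g' hle heq hg' hmin => hg' <| by
      filter_upwards [hmin, hle] with x' h1 h2
      linarith
    intro x hx
    by_cases heq : b' x = b x
    · exact ⟨(hb.operator x hx).of_le (Eventually.of_forall hle) heq,
        hmin x b (Eventually.of_forall hle) heq (hb.not_isLocalMin x hx)⟩
    · have hxz : ‖x - z‖ < 3 * s := by
        by_contra hcon
        exact heq (if_neg hcon)
      have hlt : b' x = min (b x) (g x) := if_pos hxz
      have heq' : b' x = g x := by
        rcases min_choice (b x) (g x) with h1 | h1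
        · exact absurd (hlt.trans h1) heq
        · exact hlt.trans h1
      have hnear : ∀ᶠ x' in nhds x, b' x' ≤ g x' := by
        have h5 : ∀ᶠ x' in nhds x, ‖x' - z‖ < 3 * s :=
          (by fun_prop : Continuous fun x' : EucSp N => ‖x' - z‖).continuousAt.eventually_lt_const
            hxz
        filter_upwards [h5] with x' h6
        exact (if_pos h6).trans_le (min_le_right _ _)
      exact ⟨(hgop x hx hxz).1.of_le hnear heq', hmin x g hnear heq' (hgop x hx hxz).2⟩
  refine ⟨b', ⟨fun x hx => ?_, fun x hx => ?_, fun x hx => (hop x hx).1, fun x hx => (hop x hx).2⟩,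
    ?_, fun x _ hx => if_neg (by linarith)⟩
  · by_cases hxr : ‖x - z‖ < r
    · have heq : ∀ x' ∈ closure Ω, ‖x' - z‖ < r →
          (if ‖x' - z‖ < 3 * s then min (b x') (g x') else b x') = min (b x') (g x') := by
        intro x' hx' hr'
        split_ifs with h3
        · rfl
        · have h4 : b x' < η := hrb ⟨by rwa [mem_ball, dist_eq_norm], hx'⟩
          exact (min_eq_left (h4.le.trans (hgη x' hx' (not_lt.1 h3)))).symm
      refine ((hb.continuousOn.inf hgc) x hx).congr_of_eventuallyEq ?_ (heq x hx hxr)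
      have h5 : ∀ᶠ x' in nhds x, ‖x' - z‖ < r :=
        (by fun_prop : Continuous fun x' : EucSp N => ‖x' - z‖).continuousAt.eventually_lt_const hxr
      filter_upwards [self_mem_nhdsWithin, mem_nhdsWithin_of_mem_nhds h5] with x' h6 h7
      exact heq x' h6 h7
    · have h5 : ∀ᶠ x' in nhds x, 3 * s < ‖x' - z‖ :=
        (by fun_prop : Continuous fun x' : EucSp N => ‖x' - z‖).continuousAt.eventually_const_lt
          (by linarith [not_lt.1 hxr])
      refine (hb.continuousOn x hx).congr_of_eventuallyEq ?_
        (if_neg (not_lt.2 h5.self_of_nhds.le))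
      filter_upwards [mem_nhdsWithin_of_mem_nhds h5] with x' h6
      exact if_neg (not_lt.2 h6.le)
  · simp only [hb']
    split_ifs
    exacts [le_min (hb.nonneg x hx) (hg0 x hx), hb.nonneg x hx]
  · have h1 : b' z ≤ g z := by
      simp only [hb', sub_self, norm_zero]
      rw [if_pos (by positivity)]
      exact min_le_right _ _
    refine h1.trans_eq ?_
    rw [hgeq z hz, hzy, mul_div_cancel_right₀ _ hs0.ne', hc]
    ring

theorem exists_isLateralBarrier (hα : -1 < α) (hΩb : Bornology.IsBounded Ω) (hF1 : H1 Ω F α)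
    (hF2 : H2 Ω F α a A) (hH0 : 0 ≤ H) (hH : ∀ x ∈ Ω, ∀ t ∈ Set.Ioo (0 : ℝ) T, ‖h x t‖ ≤ H)
    (hcone : UnifExtCone Ω) (hB : 0 ≤ B) {z : EucSp N} (hz : z ∈ frontier Ω) {δ ε : ℝ}
    (hδ : 0 < δ) (hε : 0 < ε) (M : ℝ) :
    ∃ b, IsLateralBarrier Ω T F h α B b ∧ b z < ε ∧
      ∀ x ∈ closure Ω, δ ≤ ‖x - z‖ → M ≤ b x := by
  obtain ⟨κ, hκ, s₁, hs₁, hball⟩ := hcone.exists_exterior_ball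
  replace hball := hball z hz
  have hzΩ : z ∈ closure Ω := frontier_subset_closure hz
  have hκ0 := hκ.1
  obtain ⟨R, hR⟩ := hΩb.closure.subset_closedBall z
  have hR0 : 0 ≤ R := by simpa using hR hzΩ
  set D := R + 4 with hD
  have hD0 : 0 < D := by positivity
  have ha := hF2.1
  obtain ⟨σ, hσ, hσD⟩ : ∃ σ > 0, A * N - a * (σ + 2) + H * D ≤ -1 := by
    have hA : 0 < A := ha.trans_le hF2.2.1
    refine ⟨(A * N + H * D + 1) / a, by positivity, ?_⟩
    have : a * ((A * N + H * D + 1) / a + 2) = A * N + H * D + 1 + 2 * a := by field_simp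
    rw [this]
    linarith
  have hσ4 : A * N - a * (σ + 2) + H * 4 ≤ -1 := by nlinarith
  have hpow : (κ / 2) ^ σ < κ ^ σ := by gcongr; linarith
  have hpow1 : κ ^ σ < 1 := Real.rpow_lt_one hκ0.le hκ.2 hσ
  set θ := (1 - κ ^ σ) / (1 - (κ / 2) ^ σ) with hθ
  have hθ0 : 0 < θ := div_pos (by linarith) (by linarith)
  have hθ1 : θ < 1 := (div_lt_one (by linarith)).2 (by linarith)
  obtain ⟨θ', hθθ', hθ'1⟩ := exists_between hθ1
  obtain ⟨b₀, hb₀, hb₀M⟩ : ∃ b, IsLateralBarrier Ω T F h α B b ∧ ∀ x ∈ closure Ω, M ≤ b x := by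
    set s := min (s₁ / 2) 1 with hs
    have hs0 : 0 < s := by positivity
    obtain ⟨y, hzy, hy⟩ := hball s ⟨hs0, (min_le_left _ _).trans_lt (by linarith)⟩
    have hκs : 0 < κ * s := by positivity
    have hyΩ : y ∉ closure Ω := fun hmem => by
      have := hy y hmem
      rw [sub_self, norm_zero] at this
      linarith
    have hxD : ∀ x ∈ closure Ω, ‖x - y‖ ≤ D := fun x hx => by
      have h1 := norm_add_le (x - z) (z - y)
      rw [sub_add_sub_cancel, hzy] at h1
      have h2 := hR hx
      rw [mem_closedBall, dist_eq_norm] at h2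
      have h3 : s ≤ 1 := min_le_right _ _
      linarith
    have hev : ∀ᶠ d in atTop, B * D ≤ (d * σ * D ^ (-σ - 1)) ^ (1 + α) :=
      ((tendsto_rpow_atTop (by linarith)).comp
        ((tendsto_id.atTop_mul_const hσ).atTop_mul_const (by positivity))).eventually_ge_atTop _
    obtain ⟨d, hd, hd0⟩ := (hev.and (eventually_gt_atTop 0)).exists
    set c := |M| + d * ((κ * s) ^ 2) ^ (-(σ / 2)) with hc
    have hM : ∀ x ∈ closure Ω, |M| ≤ c + radialPow (-d) (-(σ / 2)) y x := fun x hx => by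
      have h1 : (‖x - y‖ ^ 2) ^ (-(σ / 2)) ≤ ((κ * s) ^ 2) ^ (-(σ / 2)) := by
        refine Real.rpow_le_rpow_of_nonpos (by positivity) ?_ (by linarith)
        gcongr
        exact hy x hx
      have h2 := mul_le_mul_of_nonneg_left h1 hd0.le
      rw [radialPow, hc]
      linarith
    have hop := fun x (hx : x ∈ Ω) => operatorBoundAt_radialPow_neg (c := c) hα hF1 hF2 hH0 hH hB
      hd0 hσ hσD hx (fun hxy : x = y => hyΩ (hxy ▸ subset_closure hx)) (hxD x (subset_closure hx)) hd
    exact ⟨_, ⟨continuousOn_radialPow hyΩ, fun x hx => (abs_nonneg M).trans (hM x hx),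
      fun x hx => (hop x hx).1, fun x hx => (hop x hx).2⟩,
      fun x hx => (le_abs_self M).trans (hM x hx)⟩
  have hη : 0 < b₀ z + 1 := by linarith [hb₀.nonneg z hzΩ]
  have hiter : ∀ k : ℕ, ∃ b, IsLateralBarrier Ω T F h α B b ∧ b z < θ' ^ k * (b₀ z + 1) ∧
      ∀ x ∈ closure Ω, δ ≤ ‖x - z‖ → M ≤ b x := by
    intro k
    induction k with
    | zero => exact ⟨b₀, hb₀, by simp, fun x hx _ => hb₀M x hx⟩
    | succ k ih =>
      obtain ⟨b, hb, hbz, hbM⟩ := ih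
      obtain ⟨b', hb', hbz', heq⟩ := hb.exists_improvement hα hF1 hF2 hH0 hH hB hzΩ hκ hs₁ hball
        hσ hσ4 hbz hδ
      refine ⟨b', hb', hbz'.trans_lt ?_, fun x hx hxz => (heq x hx hxz).symm ▸ hbM x hx hxz⟩
      have h1 : 0 < θ' ^ k * (b₀ z + 1) := mul_pos (pow_pos (hθ0.trans hθθ') k) hη
      rw [pow_succ', mul_assoc]
      exact mul_lt_mul_of_pos_right hθθ' h1
  have hlim : Tendsto (fun k : ℕ => θ' ^ k * (b₀ z + 1)) atTop (nhds 0) := by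
    simpa using (tendsto_pow_atTop_nhds_zero_of_lt_one (hθ0.trans hθθ').le hθ'1).mul_const _
  obtain ⟨k, hk⟩ := (hlim.eventually_lt_const hε).exists
  obtain ⟨b, hb, hbz, hbM⟩ := hiter k
  exact ⟨b, hb, hbz.trans hk, hbM⟩

end Lateral

/-! ### Existence of supersolutions -/

section Existence

variable {Ω : Set (EucSp N)} {T : ℝ} {F : EucSp N → EucSp N → MatN N → ℝ}
  {h : EucSp N → ℝ → EucSp N} {α a A H : ℝ}

theorem exists_lateral_barrier (hα : -1 < α) (hΩb : Bornology.IsBounded Ω) (hF1 : H1 Ω F α)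
    (hF2 : H2 Ω F α a A) (hH0 : 0 ≤ H) (hH : ∀ x ∈ Ω, ∀ t ∈ Set.Ioo (0 : ℝ) T, ‖h x t‖ ≤ H)
    (hcone : UnifExtCone Ω) (hT : 0 < T) (m : ℝ) {z : EucSp N} (hz : z ∈ frontier Ω) {s₀ : ℝ}
    (hs₀ : s₀ ∈ Set.Icc 0 T) {δ ε : ℝ} (hδ : 0 < δ) (hε : 0 < ε) (M : ℝ) :
    ∃ b : EucSp N × ℝ → ℝ, ContinuousOn b (closure Ω ×ˢ Set.Icc 0 T) ∧ b (z, s₀) < ε ∧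
      (∀ q ∈ closure Ω ×ˢ Set.Icc 0 T, 0 ≤ b q) ∧
      (∀ q ∈ closure Ω ×ˢ Set.Icc 0 T, δ ≤ dist q (z, s₀) → M ≤ b q) ∧
      ∀ x ∈ Ω, ∀ t ∈ Set.Ioo (0 : ℝ) T, SuperAt F h α m b x t := by
  set L := |M| / δ ^ 2 with hL
  have hL0 : 0 ≤ L := by positivity
  obtain ⟨b, hb, hbz, hbM⟩ := exists_isLateralBarrier (B := |m| + 2 * L * T) hα hΩb hF1 hF2 hH0 hH
    hcone (by positivity) hz hδ hε M
  refine ⟨fun q => b q.1 + L * (q.2 - s₀) ^ 2, ?_, by simpa using hbz, fun q hq => ?_,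
    fun q hq hdist => ?_, fun x hx t ht => ?_⟩
  · exact (hb.continuousOn.comp continuousOn_fst fun q hq => hq.1).add (by fun_prop)
  · have := hb.nonneg q.1 hq.1
    positivity
  · have h0 := hb.nonneg q.1 hq.1
    rcases le_max_iff.1 (Prod.dist_eq (α := EucSp N) (β := ℝ) ▸ hdist) with hx | ht
    · rw [dist_eq_norm] at hx
      have := hbM q.1 hq.1 hx
      have : 0 ≤ L * (q.2 - s₀) ^ 2 := by positivity
      linarith
    · rw [Real.dist_eq] at ht
      have h2 : |M| ≤ L * (q.2 - s₀) ^ 2 := by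
        calc |M| = L * δ ^ 2 := by rw [hL]; field_simp
          _ ≤ L * |q.2 - s₀| ^ 2 := by gcongr
          _ = _ := by rw [sq_abs]
      linarith [le_abs_self M]
  · refine superAt_add (τ' := 2 * L * (t - s₀)) (τ := fun t => L * (t - s₀) ^ 2) ht
      (hb.operator x hx) ?_ ?_ (Or.inl (hb.not_isLocalMin x hx))
    · refine ((((hasDerivAt_id t).sub_const s₀).pow 2).const_mul L).congr_deriv ?_
      simp
      ring
    · have h1 : -T ≤ t - s₀ := by linarith [ht.1, hs₀.2]
      have h2 := mul_le_mul_of_nonneg_left h1 (by positivity : 0 ≤ 2 * L)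
      linarith [le_abs_self m]

theorem exists_continuous_superAt (hα : -1 < α) (hΩo : IsOpen Ω) (hΩne : Ω.Nonempty)
    (hΩb : Bornology.IsBounded Ω) (hF1 : H1 Ω F α)
    (hF2 : H2 Ω F α a A) (hH0 : 0 ≤ H) (hH : ∀ x ∈ Ω, ∀ t ∈ Set.Ioo (0 : ℝ) T, ‖h x t‖ ≤ H)
    (hcone : UnifExtCone Ω) (hT : 0 < T) (m : ℝ) {ψ : EucSp N → ℝ → ℝ}
    (hψ : ContinuousOn (fun p : EucSp N × ℝ => ψ p.1 p.2) (closure Ω ×ˢ Set.Icc 0 T)) :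
    ∃ u : EucSp N → ℝ → ℝ,
      ContinuousOn (fun p : EucSp N × ℝ => u p.1 p.2) (closure Ω ×ˢ Set.univ) ∧
      (∀ x ∈ Ω, ∀ t ∈ Set.Ioo (0 : ℝ) T, SuperAt F h α m (fun p => u p.1 p.2) x t) ∧
      BoundaryEq Ω T u ψ ∧ ∀ x ∈ closure Ω, ∀ t ∈ Set.Icc 0 T, ψ x t ≤ u x t := by
  have hΩc : IsCompact (closure Ω) := hΩb.isCompact_closure
  have hfc : IsCompact (frontier Ω) := hΩc.of_isClosed_subset isClosed_frontier
    frontier_subset_closure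
  set Q : Set (EucSp N × ℝ) := closure Ω ×ˢ Set.Icc 0 T with hQ
  have hQc : IsCompact Q := hΩc.prod isCompact_Icc
  set Γ : Set (EucSp N × ℝ) := frontier Ω ×ˢ Set.Icc 0 T ∪ closure Ω ×ˢ {0} with hΓ
  have hΓc : IsCompact Γ := (hfc.prod isCompact_Icc).union (hΩc.prod isCompact_singleton)
  have hΓQ : Γ ⊆ Q := Set.union_subset (Set.prod_mono frontier_subset_closure subset_rfl)
    (Set.prod_mono subset_rfl (Set.singleton_subset_iff.2 ⟨le_rfl, hT.le⟩))
  have hΓne : Γ.Nonempty := by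
    obtain ⟨x, hx⟩ := hΩne
    exact ⟨(x, 0), Or.inr ⟨subset_closure hx, rfl⟩⟩
  have hbar : ∀ p ∈ Γ, ∀ δ > 0, ∀ ε > 0, ∀ M : ℝ, ∃ b : EucSp N × ℝ → ℝ, ContinuousOn b Q ∧
      b p < ε ∧ (∀ q ∈ Q, 0 ≤ b q) ∧ (∀ q ∈ Q, δ ≤ dist q p → M ≤ b q) ∧
      ∀ x ∈ Ω, ∀ t ∈ Set.Ioo (0 : ℝ) T, SuperAt F h α m b x t := by
    rintro ⟨z, s₀⟩ hp δ hδ ε hε M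
    rcases hp with ⟨hz, hs₀⟩ | ⟨-, hs₀⟩
    · exact exists_lateral_barrier hα hΩb hF1 hF2 hH0 hH hcone hT m hz hs₀ hδ hε M
    · obtain rfl : s₀ = 0 := hs₀
      obtain ⟨b, hbc, hb0, hbn, hbM, hbs⟩ :=
        exists_initial_barrier hα hΩb hF1 hF2 hH0 hH m z hδ M
      exact ⟨b, hbc.continuousOn, hb0.trans_lt hε, fun q hq => hbn q hq.2.1,
        fun q hq => hbM q hq.2.1, hbs⟩
  obtain ⟨K, hK⟩ := hQc.bddAbove_image hψ
  obtain ⟨W, hWc, hWψ, hWΓ, hWt⟩ := exists_inf_of_barriers hΓc hΓQ hΓne hψ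
    (fun w => ∀ x ∈ Ω, ∀ t ∈ Set.Ioo (0 : ℝ) T, SuperAt F h α m w x t) (by
      intro p hp ε hε M
      obtain ⟨r, hr, hrψ⟩ := Metric.mem_nhdsWithin_iff.1
        ((hψ p (hΓQ hp)).eventually_lt_const
          (lt_add_of_pos_right (ψ p.1 p.2) (half_pos hε)))
      obtain ⟨b, hbc, hbp, hb0, hbM, hbs⟩ := hbar p hp (min ε r) (lt_min hε hr) (ε / 2)
        (half_pos hε) (max M K - ψ p.1 p.2)
      have hfar : ∀ q ∈ Q, min ε r ≤ dist q p → max M K ≤ b q + (ψ p.1 p.2 + ε / 2) :=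
        fun q hq hd => by linarith [hbM q hq hd]
      refine ⟨fun q => b q + (ψ p.1 p.2 + ε / 2), fun x hx t ht => (hbs x hx t ht).add_const _,
        hbc.add continuousOn_const, fun q hq => ?_, by linarith, fun q hq hd =>
          (le_max_left _ _).trans (hfar q hq ((min_le_left _ _).trans hd))⟩
      by_cases hqr : dist q p < r
      · have h1 : ψ q.1 q.2 < ψ p.1 p.2 + ε / 2 := hrψ ⟨hqr, hq⟩
        linarith [hb0 q hq]
      · exact (hK (Set.mem_image_of_mem _ hq)).trans ((le_max_right _ _).trans
          (hfar q hq ((min_le_right _ _).trans (not_lt.1 hqr)))))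
  refine ⟨fun x t => W (x, Set.projIcc 0 T hT.le t), ?_, fun x hx t ht => ?_, ⟨?_, ?_⟩, ?_⟩
  · refine hWc.comp (Continuous.continuousOn ?_) fun p hp => ⟨hp.1, Subtype.coe_prop _⟩
    exact continuous_fst.prodMk
      (continuous_subtype_val.comp (continuous_projIcc.comp continuous_snd))
  · have hproj : ∀ t ∈ Set.Ioo 0 T, (Set.projIcc 0 T hT.le t : ℝ) = t := fun t ht => by
      rw [Set.projIcc_of_mem hT.le (Set.Ioo_subset_Icc_self ht)]
    have hxtΓ : (x, t) ∉ Γ := by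
      rintro (hxt | hxt)
      · exact (hΩo.frontier_eq ▸ hxt.1).2 hx
      · exact ht.1.ne' hxt.2
    obtain ⟨w, hw, heq, hle⟩ := hWt (x, t) ⟨subset_closure hx, Set.Ioo_subset_Icc_self ht⟩ hxtΓ
    refine (hw x hx t ht).of_le ?_ ?_
    · filter_upwards [(hΩo.prod isOpen_Ioo).mem_nhds (Set.mk_mem_prod hx ht)] with p hp
      rw [hproj p.2 hp.2]
      exact hle p ⟨subset_closure hp.1, Set.Ioo_subset_Icc_self hp.2⟩
    · simpa only [hproj t ht] using heq
  · intro x hx t ht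
    have ht' := Set.Ioo_subset_Icc_self ht
    dsimp only
    rw [Set.projIcc_of_mem hT.le ht']
    exact hWΓ (x, t) (Or.inl ⟨hx, ht'⟩)
  · intro x hx
    dsimp only
    rw [Set.projIcc_left]
    exact hWΓ (x, 0) (Or.inr ⟨subset_closure hx, rfl⟩)
  · intro x hx t ht
    dsimp only
    rw [Set.projIcc_of_mem hT.le ht]
    exact hWψ (x, t) ⟨hx, ht⟩

end Existence

/-! ### Reflection -/

section Reflection

variable {Ω : Set (EucSp N)} {T : ℝ} {F : EucSp N → EucSp N → MatN N → ℝ}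
  {h : EucSp N → ℝ → EucSp N} {α a A : ℝ}

/-- The operator satisfied by `-u` when `u` is a solution for `F`. -/
def reflectOp (F : EucSp N → EucSp N → MatN N → ℝ) (x p : EucSp N) (X : MatN N) : ℝ :=
  -F x (-p) (-X)

theorem H1.reflectOp (hF1 : H1 Ω F α) : H1 Ω (reflectOp F) α := by
  intro x hx p hp X hX t ht μ hμ
  rw [_root_.reflectOp, ← smul_neg, ← smul_neg,
    hF1 x hx (-p) (neg_ne_zero.2 hp) (-X) hX.neg t ht μ hμ, _root_.reflectOp]
  ring

theorem H2.reflectOp (hF2 : H2 Ω F α a A) : H2 Ω (reflectOp F) α a A := by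
  refine ⟨hF2.1, hF2.2.1, fun x hx p hp M P hM hP hPp => ?_⟩
  have := hF2.2.2 x hx (-p) (neg_ne_zero.2 hp) (-(M + P)) P (hM.add hP).neg hP hPp
  rw [norm_neg, neg_add_rev, neg_add_cancel_comm, add_comm (-P)] at this
  simp only [_root_.reflectOp, neg_add]
  exact ⟨by linarith [this.1], by linarith [this.2]⟩

theorem gradTerm_neg (x : EucSp N) (t : ℝ) (p : EucSp N) :
    gradTerm h α x t (-p) = -gradTerm h α x t p := by
  rw [gradTerm, gradTerm, inner_neg_right, norm_neg, neg_mul]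

theorem gradient_fun_neg_eq (φ : EucSp N → ℝ) (x : EucSp N) :
    gradient (fun x => -φ x) x = -gradient φ x := by
  simp [gradient, fderiv_fun_neg]

theorem hessMat_neg (φ : EucSp N → ℝ) (x : EucSp N) :
    hessMat (fun x => -φ x) x = -hessMat φ x := by
  ext i j
  have h1 : fderiv ℝ (fun x => -φ x) = fun x => -fderiv ℝ φ x := funext fun x => fderiv_fun_neg
  rw [Matrix.neg_apply, hessMat_apply, hessMat_apply, h1, fderiv_fun_neg]
  rfl

theorem uscEnv_eq_of_continuousAt {u : EucSp N → ℝ → ℝ} {x : EucSp N} {t : ℝ}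
    (hu : ContinuousAt (fun p : EucSp N × ℝ => u p.1 p.2) (x, t)) : uscEnv u x t = u x t :=
  Tendsto.limsup_eq hu

theorem isSubSol_neg_of_isSuperSol (hΩ : IsOpen Ω) {m : ℝ} {u : EucSp N → ℝ → ℝ}
    (hu : ContinuousOn (fun p : EucSp N × ℝ => u p.1 p.2) (Ω ×ˢ Set.univ))
    (hs : IsSuperSol Ω T (reflectOp F) h α (fun _ _ => m) u) :
    IsSubSol Ω T F h α (fun _ _ => -m) (fun x t => -u x t) := by
  have henv : ∀ x ∈ Ω, ∀ t, uscEnv (fun x t => -u x t) x t = -lscEnv u x t := fun x hx t => by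
    have hc : ContinuousAt (fun p : EucSp N × ℝ => u p.1 p.2) (x, t) := hu.continuousAt
      ((hΩ.prod isOpen_univ).mem_nhds ⟨hx, Set.mem_univ t⟩)
    rw [lscEnv_eq_of_continuousAt hc]
    exact uscEnv_eq_of_continuousAt hc.neg
  intro x₀ hx₀ t₀ ht₀
  have hev : ∀ᶠ x in nhds x₀, x ∈ Ω := hΩ.mem_nhds hx₀
  refine ⟨fun φ hφ hle heq hg => ?_, fun δ hδ φ hφ hφ0 hle hsup => ?_⟩
  · have := (hs x₀ hx₀ t₀ ht₀).1 (fun x t => -φ x t) hφ.neg ?_ ?_ ?_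
    · rw [gradient_fun_neg_eq, hessMat_neg, gradTerm_neg, reflectOp, neg_neg, neg_neg,
        deriv.fun_neg] at this
      linarith
    · filter_upwards [hle, continuous_fst.continuousAt.eventually hev] with p h1 h2
      rw [henv _ h2] at h1
      linarith
    · rw [henv _ hx₀] at heq
      linarith
    · rwa [gradient_fun_neg_eq, neg_ne_zero]
  · have himg : ∀ x ∈ Ω, (fun t => uscEnv (fun x t => -u x t) x t - φ t) ''
        Set.Ioo (t₀ - δ) (t₀ + δ) =
        -((fun t => lscEnv u x t - -φ t) '' Set.Ioo (t₀ - δ) (t₀ + δ)) := fun x hx => by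
      rw [← Set.image_neg_eq_neg, Set.image_image]
      refine Set.image_congr fun t _ => ?_
      rw [henv x hx]
      ring
    have := (hs x₀ hx₀ t₀ ht₀).2 δ hδ (fun t => -φ t) hφ.neg (by simp [hφ0]) ?_ ?_
    · rw [deriv.fun_neg] at this
      linarith
    · intro t ht
      have := hle t ht
      rw [henv _ hx₀, henv _ hx₀] at this
      linarith
    · filter_upwards [hsup, hev] with x h1 h2
      rw [himg x h2, himg x₀ hx₀, Real.sSup_neg, Real.sSup_neg] at h1
      exact neg_injective h1

end Reflection

theorem PsiHolderLip.continuousOn {Ω : Set (EucSp N)} {T γ cψ Lψ : ℝ} {ψ : EucSp N → ℝ → ℝ}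
    (hψ : PsiHolderLip Ω T γ cψ Lψ ψ) (hγ : 0 < γ) :
    ContinuousOn (fun p : EucSp N × ℝ => ψ p.1 p.2) (closure Ω ×ˢ Set.Icc 0 T) := by
  intro p hp
  have hlim : Tendsto (fun q : EucSp N × ℝ => cψ * ‖q.1 - p.1‖ ^ γ + Lψ * |q.2 - p.2|)
      (nhdsWithin p (closure Ω ×ˢ Set.Icc 0 T)) (nhds 0) := by
    have hc : Continuous fun q : EucSp N × ℝ => cψ * ‖q.1 - p.1‖ ^ γ + Lψ * |q.2 - p.2| :=
      (continuous_const.mul ((by fun_prop : Continuous fun q : EucSp N × ℝ =>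
        ‖q.1 - p.1‖).rpow_const fun _ => Or.inr hγ.le)).add (by fun_prop)
    have := hc.tendsto p
    simp only [sub_self, norm_zero, Real.zero_rpow hγ.ne', abs_zero, mul_zero, add_zero] at this
    exact this.mono_left nhdsWithin_le_nhds
  refine tendsto_iff_dist_tendsto_zero.2 (squeeze_zero' (Eventually.of_forall fun _ => dist_nonneg)
    ?_ hlim)
  filter_upwards [self_mem_nhdsWithin] with q hq
  rw [Real.dist_eq]
  have h1 := hψ.1 q.1 hq.1 p.1 hp.1 q.2 hq.2
  have h2 := hψ.2 p.1 hp.1 q.2 hq.2 p.2 hp.2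
  exact (abs_sub_le _ _ _).trans (add_le_add h1 h2)

/-- Existence of parabolic barriers (Proposition 2 of the paper). -/
theorem parabolic_barriers
    (N : ℕ) (hN : 1 ≤ N) (α : ℝ) (hα : -1 < α)
    (Ω : Set (EucSp N)) (hΩo : IsOpen Ω) (hΩconn : IsConnected Ω)
    (hΩb : Bornology.IsBounded Ω) (hcone : UnifExtCone Ω)
    (T : ℝ) (hT : 0 < T)
    (F : EucSp N → EucSp N → MatN N → ℝ) (a A : ℝ)
    (hFc : Fcont Ω F) (hF1 : H1 Ω F α) (hF2 : H2 Ω F α a A) (hF3 : H3 Ω F)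
    (h : EucSp N → ℝ → EucSp N) (hh : HContBdd Ω T h) (hh5 : H5 Ω T h α)
    (γ c₁ c₂ : ℝ) (hbar : IsBarrierFamily Ω T F h α γ c₁ c₂)
    (ψ : EucSp N → ℝ → ℝ) (cψ Lψ : ℝ) (hcψ : 0 < cψ) (hLψ : 0 < Lψ)
    (hψ : PsiHolderLip Ω T γ cψ Lψ ψ)
    (f : EucSp N → ℝ → ℝ) (Mf : ℝ)
    (hfb : ∀ x ∈ Ω, ∀ t ∈ Set.Ioo (0 : ℝ) T, |f x t| ≤ Mf) :
    ∃ W V : EucSp N → ℝ → ℝ,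
      ContinuousOn (fun p : EucSp N × ℝ => W p.1 p.2) (closure Ω ×ˢ Set.Icc 0 T) ∧
      IsSuperSol Ω T F h α (fun _ _ => Mf) W ∧ BoundaryEq Ω T W ψ ∧
      ContinuousOn (fun p : EucSp N × ℝ => V p.1 p.2) (closure Ω ×ˢ Set.Icc 0 T) ∧
      IsSubSol Ω T F h α (fun _ _ => -Mf) V ∧ BoundaryEq Ω T V ψ ∧
      (∀ x ∈ Ω, ∀ t ∈ Set.Ioo (0 : ℝ) T, V x t ≤ W x t) := by
  obtain ⟨C, hC⟩ := hh.2
  have hH : ∀ x ∈ Ω, ∀ t ∈ Set.Ioo (0 : ℝ) T, ‖h x t‖ ≤ max C 0 := fun x hx t ht =>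
    (hC x hx t ht).trans (le_max_left _ _)
  have hψc := hψ.continuousOn hbar.1.1
  obtain ⟨W, hWc, hWs, hWb, hWψ⟩ := exists_continuous_superAt hα hΩo hΩconn.nonempty hΩb hF1 hF2
    (le_max_right _ _) hH hcone hT Mf hψc
  obtain ⟨U, hUc, hUs, hUb, hUψ⟩ := exists_continuous_superAt (ψ := fun x t => -ψ x t) hα hΩo
    hΩconn.nonempty hΩb hF1.reflectOp hF2.reflectOp (le_max_right _ _) hH hcone hT Mf hψc.neg
  have hQ : closure Ω ×ˢ Set.Icc 0 T ⊆ closure Ω ×ˢ (Set.univ : Set ℝ) :=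
    Set.prod_mono subset_rfl (Set.subset_univ _)
  have hΩQ : Ω ×ˢ (Set.univ : Set ℝ) ⊆ closure Ω ×ˢ Set.univ :=
    Set.prod_mono subset_closure subset_rfl
  refine ⟨W, fun x t => -U x t, hWc.mono hQ, isSuperSol_of_superAt hΩo (hWc.mono hΩQ) hWs, hWb,
    (hUc.mono hQ).neg, isSubSol_neg_of_isSuperSol hΩo (hUc.mono hΩQ)
      (isSuperSol_of_superAt hΩo (hUc.mono hΩQ) hUs), ⟨fun x hx t ht => ?_, fun x hx => ?_⟩,
    fun x hx t ht => ?_⟩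
  · simp only [hUb.1 x hx t ht, neg_neg]
  · simp only [hUb.2 x hx, neg_neg]
  · have h1 := hWψ x (subset_closure hx) t (Set.Ioo_subset_Icc_self ht)
    have h2 := hUψ x (subset_closure hx) t (Set.Ioo_subset_Icc_self ht)
    linarith
end
end
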